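/- arXiv:2011.00308 — 3 statements merged into one kernel-verified Lean document; each statement's English description precedes it below -/
import Mathlib

section
/- Assume the stationary-densities setting together with the heat kernel bound and the transition density convergence assumption. Then there exists a constant C > 0 such that for every compact set S ⊆ ℝ^d with Leb(S) < 1, every bounded measurable f : ℝ^d → ℝ whose support is contained in S, and every T > 0, Var(∫₀^T f(X_t) dt) ≤ C (1 ∨ c_S) T ‖f‖_∞² Leb(S) μ(S) ψ_d(Leb(S))², where the variance is taken under ℙ. -/
open MeasureTheory ProbabilityTheory
open scoped ENNReal

/-- The function `ψ_d` from the paper. -/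
noncomputable def psiFun (d : ℕ) (x : ℝ) : ℝ :=
  if d = 1 then 1
  else if d = 2 then Real.sqrt (1 + Real.log (1 / x))
  else x ^ ((1 : ℝ) / d - 1 / 2)

section Covariance

variable {Ω : Type*} [MeasurableSpace Ω] {P : Measure Ω} [IsProbabilityMeasure P]

lemma memLp_two_of_abs_le {W : Ω → ℝ} (hW : Measurable W) {M : ℝ} (hM : ∀ ω, |W ω| ≤ M) :
    MemLp W 2 P :=
  MemLp.of_bound hW.aestronglyMeasurable M (.of_forall hM)

lemma measurable_intervalIntegral_process {Z : ℝ → Ω → ℝ}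
    (hZ : Measurable (Function.uncurry Z)) {T : ℝ} (hT : 0 < T) :
    Measurable fun ω => ∫ t in (0 : ℝ)..T, Z t ω := by
  simp_rw [intervalIntegral.integral_of_le hT.le]
  exact (StronglyMeasurable.integral_prod_left (f := Z) hZ.stronglyMeasurable).measurable

lemma abs_intervalIntegral_process_le {Ω : Type*} {Z : ℝ → Ω → ℝ} {M : ℝ} (hM : ∀ t ω, |Z t ω| ≤ M)
    {T : ℝ} (hT : 0 < T) (ω : Ω) : |∫ t in (0 : ℝ)..T, Z t ω| ≤ M * T := by
  have := intervalIntegral.norm_integral_le_of_norm_le_const (a := 0) (b := T)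
    (f := fun t => Z t ω) (C := M) (fun t _ => hM t ω)
  simpa [abs_of_pos hT] using this

/-- Covariance against a time integral of a bounded process is the time integral of the
covariances. -/
lemma covariance_intervalIntegral_right {W : Ω → ℝ} (hW : Measurable W) {L : ℝ}
    (hL : ∀ ω, |W ω| ≤ L) {Z : ℝ → Ω → ℝ} (hZ : Measurable (Function.uncurry Z)) {M : ℝ}
    (hM : ∀ t ω, |Z t ω| ≤ M) {T : ℝ} (hT : 0 < T) :
    cov[W, fun ω => ∫ t in (0 : ℝ)..T, Z t ω; P] = ∫ t in (0 : ℝ)..T, cov[W, Z t; P] := by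
  have hZt (t : ℝ) : Measurable (Z t) := hZ.of_uncurry_left
  have hWZ (t : ℝ) : cov[W, Z t; P] = ∫ ω, W ω * Z t ω ∂P - (∫ ω, W ω ∂P) * ∫ ω, Z t ω ∂P :=
    covariance_eq_sub (memLp_two_of_abs_le hW hL) (memLp_two_of_abs_le (hZt t) (hM t))
  have hWZ' : Measurable fun q : ℝ × Ω => W q.2 * Z q.1 q.2 := (hW.comp measurable_snd).mul hZ
  have hbound (t : ℝ) (ω : Ω) : ‖W ω * Z t ω‖ ≤ L * M := by
    rw [norm_mul]
    exact mul_le_mul (hL ω) (hM t ω) (norm_nonneg _) ((abs_nonneg _).trans (hL ω))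
  have hint₁ : Integrable (fun q : ℝ × Ω => W q.2 * Z q.1 q.2)
      ((volume.restrict (Set.Ioc 0 T)).prod P) :=
    .of_bound hWZ'.aestronglyMeasurable (L * M) (.of_forall fun q => hbound q.1 q.2)
  have hint₂ : Integrable (fun q : ℝ × Ω => Z q.1 q.2) ((volume.restrict (Set.Ioc 0 T)).prod P) :=
    .of_bound hZ.aestronglyMeasurable M (.of_forall fun q => hM q.1 q.2)
  rw [covariance_eq_sub (memLp_two_of_abs_le hW hL)
    (memLp_two_of_abs_le (measurable_intervalIntegral_process hZ hT)
      (abs_intervalIntegral_process_le hM hT))]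
  simp_rw [hWZ, Pi.mul_apply, intervalIntegral.integral_of_le hT.le]
  rw [integral_sub hint₁.integral_prod_left (hint₂.integral_prod_left.const_mul _),
    integral_const_mul, integral_integral_swap (f := fun t ω => W ω * Z t ω) hint₁,
    integral_integral_swap (f := Z) hint₂]
  simp_rw [integral_const_mul]

lemma integrable_comp_abs_of_integrableOn_Ioi {k : ℝ → ℝ} (hk : IntegrableOn k (Set.Ioi 0)) :
    Integrable fun v => k |v| := by
  have hpos : IntegrableOn (fun v => k |v|) (Set.Ioi 0) :=
    hk.congr_fun (fun v hv => by simp [abs_of_pos (Set.mem_Ioi.1 hv)]) measurableSet_Ioi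
  have hneg : IntegrableOn (fun v => k |v|) (Set.Iic 0) := by
    simpa using (show IntegrableOn (fun v => k |v|) (Set.Ici (-0)) by
      simpa [integrableOn_Ici_iff_integrableOn_Ioi] using hpos).comp_neg_Iic
  have := hneg.union hpos
  rwa [Set.Iic_union_Ioi, integrableOn_univ] at this

/-- Variance of a time integral of a bounded process whose covariances are dominated by an
integrable function of the time difference. -/
lemma variance_intervalIntegral_le {Z : ℝ → Ω → ℝ} (hZ : Measurable (Function.uncurry Z)) {M : ℝ}
    (hM : ∀ t ω, |Z t ω| ≤ M) {k : ℝ → ℝ} (hk0 : ∀ t, 0 ≤ k t) (hk : IntegrableOn k (Set.Ioi 0))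
    (hcov : ∀ s u : ℝ, 0 ≤ s → s < u → |cov[Z s, Z u; P]| ≤ k (u - s)) {T : ℝ} (hT : 0 < T) :
    Var[fun ω => ∫ t in (0 : ℝ)..T, Z t ω; P] ≤ 2 * T * ∫ t in Set.Ioi 0, k t := by
  have hZt (t : ℝ) : Measurable (Z t) := hZ.of_uncurry_left
  have hY := measurable_intervalIntegral_process hZ hT
  have hYb := abs_intervalIntegral_process_le hM hT
  have hkint := integrable_comp_abs_of_integrableOn_Ioi hk
  have hinner (s : ℝ) (hs : 0 ≤ s) :
      ‖cov[fun ω => ∫ t in (0 : ℝ)..T, Z t ω, Z s; P]‖ ≤ 2 * ∫ t in Set.Ioi 0, k t := by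
    rw [covariance_comm, covariance_intervalIntegral_right (hZt s) (hM s) hZ hM hT,
      intervalIntegral.integral_of_le hT.le]
    have hshift : Integrable fun u => k |u - s| := hkint.comp_sub_right s
    calc ‖∫ u in Set.Ioc 0 T, cov[Z s, Z u; P]‖
        ≤ ∫ u in Set.Ioc 0 T, k |u - s| := by
          refine norm_integral_le_of_norm_le hshift.integrableOn ?_
          have hne : ∀ᵐ u : ℝ ∂volume.restrict (Set.Ioc 0 T), u ≠ s :=
            ae_restrict_of_ae (Measure.ae_ne volume s)
          filter_upwards [hne, ae_restrict_mem measurableSet_Ioc] with u hu hmem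
          rcases hu.lt_or_gt with h | h
          · rw [covariance_comm, abs_sub_comm, abs_of_pos (sub_pos.2 h)]
            exact hcov u s hmem.1.le h
          · rw [abs_of_pos (sub_pos.2 h)]
            exact hcov s u hs h
      _ ≤ ∫ u, k |u - s| :=
          setIntegral_le_integral hshift (.of_forall fun u => hk0 _)
      _ = 2 * ∫ t in Set.Ioi 0, k t := by
          rw [integral_sub_right_eq_self (fun u => k |u|) s, integral_comp_abs]
  rw [← covariance_self hY.aemeasurable, covariance_intervalIntegral_right hY hYb hZ hM hT]
  refine (le_abs_self _).trans ?_
  have := intervalIntegral.norm_integral_le_of_norm_le_const (a := 0) (b := T)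
    (f := fun s => cov[fun ω => ∫ t in (0 : ℝ)..T, Z t ω, Z s; P])
    (C := 2 * ∫ t in Set.Ioi 0, k t) (fun s hs => hinner s (by
      rw [Set.uIoc_of_le hT.le] at hs; exact hs.1.le))
  rw [sub_zero, abs_of_pos hT, Real.norm_eq_abs] at this
  linarith

end Covariance

section Densities

variable {Ω E : Type*} [MeasurableSpace Ω] {P : Measure Ω} [MeasurableSpace E]
  {ν : Measure E} [SFinite ν] {ρ : E → ℝ} {q : E → E → ℝ} {U V : Ω → E}

/-- If the conditional density of `V` given `U` is bounded by `A`, then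
`P(U ∈ S₁, V ∈ S₂) ≤ A P(U ∈ S₁) ν(S₂)`. -/
lemma measure_inter_preimage_le_of_density_le (hρ : Measurable ρ) (hρ0 : ∀ x, 0 ≤ ρ x)
    (hU : Measurable U) (hV : Measurable V)
    (hpair : P.map (fun ω => (U ω, V ω)) =
      (ν.prod ν).withDensity fun z => ENNReal.ofReal (ρ z.1 * q z.1 z.2))
    (hUlaw : P.map U = ν.withDensity fun x => ENNReal.ofReal (ρ x))
    {A : ℝ} (hA : ∀ x y, q x y ≤ A) {S₁ S₂ : Set E} (hS₁ : MeasurableSet S₁)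
    (hS₂ : MeasurableSet S₂) :
    P (U ⁻¹' S₁ ∩ V ⁻¹' S₂) ≤ P (U ⁻¹' S₁) * (ENNReal.ofReal A * ν S₂) := by
  have hpre : U ⁻¹' S₁ ∩ V ⁻¹' S₂ = (fun ω => (U ω, V ω)) ⁻¹' (S₁ ×ˢ S₂) := rfl
  rw [hpre, ← Measure.map_apply (hU.prodMk hV) (hS₁.prod hS₂), hpair,
    withDensity_apply _ (hS₁.prod hS₂), ← Measure.map_apply hU hS₁, hUlaw,
    withDensity_apply _ hS₁, ← Measure.prod_restrict]
  calc ∫⁻ z, ENNReal.ofReal (ρ z.1 * q z.1 z.2) ∂(ν.restrict S₁).prod (ν.restrict S₂)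
      ≤ ∫⁻ z, ENNReal.ofReal (ρ z.1) * ENNReal.ofReal A
          ∂(ν.restrict S₁).prod (ν.restrict S₂) := by
        refine lintegral_mono fun z => ?_
        rw [← ENNReal.ofReal_mul (hρ0 _)]
        exact ENNReal.ofReal_le_ofReal (mul_le_mul_of_nonneg_left (hA _ _) (hρ0 _))
    _ = _ := by
        rw [lintegral_prod_mul (g := fun _ => ENNReal.ofReal A) hρ.ennreal_ofReal.aemeasurable
          aemeasurable_const]
        simp

lemma abs_covariance_comp_le [IsProbabilityMeasure P] {f : E → ℝ} (hf : Measurable f) {S : Set E} (hS : MeasurableSet S)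
    (hfS : Function.support f ⊆ S) {M : ℝ} (hM : ∀ x, |f x| ≤ M)
    (hU : Measurable U) (hV : Measurable V) :
    |cov[fun ω => f (U ω), fun ω => f (V ω); P]| ≤
      M ^ 2 * (P.real (U ⁻¹' S ∩ V ⁻¹' S) + P.real (U ⁻¹' S) * P.real (V ⁻¹' S)) := by
  have hzero {x : E} (hx : x ∉ S) : f x = 0 := by
    by_contra h
    exact hx (hfS h)
  have hmean {W : Ω → E} (hW : Measurable W) : |∫ ω, f (W ω) ∂P| ≤ M * P.real (W ⁻¹' S) := by
    have := norm_integral_le_of_norm_le (μ := P) (f := fun ω => f (W ω))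
      (g := (W ⁻¹' S).indicator fun _ => M)
      ((integrable_const M).indicator (hW hS)) (.of_forall fun ω => by
        by_cases h : W ω ∈ S
        · simpa [h] using hM (W ω)
        · simp [h, hzero h])
    rwa [integral_indicator_const _ (hW hS), smul_eq_mul, mul_comm] at this
  have hjoint : |∫ ω, f (U ω) * f (V ω) ∂P| ≤ M ^ 2 * P.real (U ⁻¹' S ∩ V ⁻¹' S) := by
    have hms : MeasurableSet (U ⁻¹' S ∩ V ⁻¹' S) := (hU hS).inter (hV hS)
    have := norm_integral_le_of_norm_le (μ := P) (f := fun ω => f (U ω) * f (V ω))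
      (g := (U ⁻¹' S ∩ V ⁻¹' S).indicator fun _ => M ^ 2)
      ((integrable_const _).indicator hms) (.of_forall fun ω => by
        by_cases h : U ω ∈ S
        · by_cases h' : V ω ∈ S
          · simpa [h, h', sq] using
              mul_le_mul (hM (U ω)) (hM (V ω)) (abs_nonneg _) ((abs_nonneg _).trans (hM (U ω)))
          · simp [h', hzero h']
        · simp [h, hzero h])
    rwa [integral_indicator_const _ hms, smul_eq_mul, mul_comm] at this
  rw [covariance_eq_sub
    (memLp_two_of_abs_le (W := fun ω => f (U ω)) (hf.comp hU) fun ω => hM _)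
    (memLp_two_of_abs_le (W := fun ω => f (V ω)) (hf.comp hV) fun ω => hM _)]
  have hprod := mul_le_mul (hmean hU) (hmean hV) (abs_nonneg _)
    ((abs_nonneg _).trans (hmean hU))
  rw [← abs_mul] at hprod
  refine (abs_sub _ _).trans ?_
  simp only [Pi.mul_apply]
  linarith

/-- If the conditional density of `V` given `U` is uniformly close to `ρ` on `S`, then the
covariance is small. -/
lemma abs_covariance_comp_le_of_density_close [IsProbabilityMeasure P] (hρ : Measurable ρ) (hρ0 : ∀ x, 0 ≤ ρ x)
    (hq : Measurable (Function.uncurry q)) (hq0 : ∀ x y, 0 ≤ q x y)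
    (hU : Measurable U) (hV : Measurable V)
    (hpair : P.map (fun ω => (U ω, V ω)) =
      (ν.prod ν).withDensity fun z => ENNReal.ofReal (ρ z.1 * q z.1 z.2))
    (hUlaw : P.map U = ν.withDensity fun x => ENNReal.ofReal (ρ x))
    (hVlaw : P.map V = ν.withDensity fun x => ENNReal.ofReal (ρ x))
    {f : E → ℝ} (hf : Measurable f) {S : Set E} (hS : MeasurableSet S) (hSν : ν S ≠ ∞)
    (hfS : Function.support f ⊆ S) {M : ℝ} (hM : ∀ x, |f x| ≤ M)
    {R : ℝ} (hR : ∀ᵐ x ∂P.map U, x ∈ S → ∀ y ∈ S, |q x y - ρ y| ≤ R) :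
    |cov[fun ω => f (U ω), fun ω => f (V ω); P]| ≤ M ^ 2 * (P.real (U ⁻¹' S) * ν.real S * R) := by
  have hzero {x : E} (hx : x ∉ S) : f x = 0 := by
    by_contra h
    exact hx (hfS h)
  have hff : Measurable fun z : E × E => f z.1 * f z.2 :=
    (hf.comp measurable_fst).mul (hf.comp measurable_snd)
  have hffb (z : E × E) : ‖f z.1 * f z.2‖ ≤ M * M := by
    rw [norm_mul]
    exact mul_le_mul (hM _) (hM _) (norm_nonneg _) ((abs_nonneg _).trans (hM z.1))
  have hd₁ : Measurable fun z : E × E => ENNReal.ofReal (ρ z.1 * q z.1 z.2) :=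
    ((hρ.comp measurable_fst).mul hq).ennreal_ofReal
  have hd₂ : Measurable fun z : E × E => ENNReal.ofReal (ρ z.1 * ρ z.2) :=
    ((hρ.comp measurable_fst).mul (hρ.comp measurable_snd)).ennreal_ofReal
  have hprod : (P.map U).prod (P.map V) =
      (ν.prod ν).withDensity fun z => ENNReal.ofReal (ρ z.1 * ρ z.2) := by
    rw [hUlaw, hVlaw, prod_withDensity hρ.ennreal_ofReal hρ.ennreal_ofReal]
    simp_rw [ENNReal.ofReal_mul (hρ0 _)]
  have : IsProbabilityMeasure (P.map U) := Measure.isProbabilityMeasure_map hU.aemeasurable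
  have : IsProbabilityMeasure (P.map V) := Measure.isProbabilityMeasure_map hV.aemeasurable
  have : IsProbabilityMeasure (P.map fun ω => (U ω, V ω)) :=
    Measure.isProbabilityMeasure_map (hU.prodMk hV).aemeasurable
  have hint₁ : Integrable (fun z : E × E => f z.1 * f z.2 * (ρ z.1 * q z.1 z.2)) (ν.prod ν) := by
    have : Integrable (fun z : E × E => f z.1 * f z.2) (P.map fun ω => (U ω, V ω)) :=
      .of_bound hff.aestronglyMeasurable _ (.of_forall hffb)
    rw [hpair, integrable_withDensity_iff hd₁ (by simp)] at this
    simpa only [ENNReal.toReal_ofReal (mul_nonneg (hρ0 _) (hq0 _ _))] using this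
  have hint₂ : Integrable (fun z : E × E => f z.1 * f z.2 * (ρ z.1 * ρ z.2)) (ν.prod ν) := by
    have : Integrable (fun z : E × E => f z.1 * f z.2) ((P.map U).prod (P.map V)) :=
      .of_bound hff.aestronglyMeasurable _ (.of_forall hffb)
    rw [hprod, integrable_withDensity_iff hd₂ (by simp)] at this
    simpa only [ENNReal.toReal_ofReal (mul_nonneg (hρ0 _) (hρ0 _))] using this
  have hcov : cov[fun ω => f (U ω), fun ω => f (V ω); P] =
      ∫ z, f z.1 * f z.2 * (ρ z.1 * (q z.1 z.2 - ρ z.2)) ∂ν.prod ν := by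
    have h₁ : ∫ ω, f (U ω) * f (V ω) ∂P =
        ∫ z, f z.1 * f z.2 * (ρ z.1 * q z.1 z.2) ∂ν.prod ν := by
      rw [← integral_map (φ := fun ω => (U ω, V ω)) (f := fun z : E × E => f z.1 * f z.2)
        (hU.prodMk hV).aemeasurable hff.aestronglyMeasurable, hpair,
        integral_withDensity_eq_integral_toReal_smul hd₁ (by simp)]
      simp only [ENNReal.toReal_ofReal (mul_nonneg (hρ0 _) (hq0 _ _)), smul_eq_mul, mul_comm]
    have h₂ : (∫ ω, f (U ω) ∂P) * ∫ ω, f (V ω) ∂P =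
        ∫ z, f z.1 * f z.2 * (ρ z.1 * ρ z.2) ∂ν.prod ν := by
      rw [← integral_map hU.aemeasurable hf.aestronglyMeasurable,
        ← integral_map hV.aemeasurable hf.aestronglyMeasurable, ← integral_prod_mul, hprod,
        integral_withDensity_eq_integral_toReal_smul hd₂ (by simp)]
      simp only [ENNReal.toReal_ofReal (mul_nonneg (hρ0 _) (hρ0 _)), smul_eq_mul, mul_comm]
    rw [covariance_eq_sub
      (memLp_two_of_abs_le (W := fun ω => f (U ω)) (hf.comp hU) fun ω => hM _)
      (memLp_two_of_abs_le (W := fun ω => f (V ω)) (hf.comp hV) fun ω => hM _)]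
    simp only [Pi.mul_apply]
    rw [h₁, h₂, ← integral_sub hint₁ hint₂]
    congr with z
    ring
  have hρS : ∫ x in S, ρ x ∂ν = P.real (U ⁻¹' S) := by
    rw [measureReal_def, ← Measure.map_apply hU hS, hUlaw, withDensity_apply _ hS,
      integral_eq_lintegral_of_nonneg_ae (.of_forall hρ0) hρ.aestronglyMeasurable]
  have hρSint : IntegrableOn ρ S ν := by
    have : Integrable (fun _ : E => (1 : ℝ)) (P.map U) := integrable_const _
    rw [hUlaw, integrable_withDensity_iff hρ.ennreal_ofReal (by simp)] at this
    simp only [ENNReal.toReal_ofReal (hρ0 _), one_mul] at this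
    exact this.integrableOn
  have hR' : ∀ᵐ x ∂ν, ρ x ≠ 0 → x ∈ S → ∀ y ∈ S, |q x y - ρ y| ≤ R := by
    rw [hUlaw, ae_withDensity_iff hρ.ennreal_ofReal] at hR
    filter_upwards [hR] with x hx hne
    exact hx (by simpa using lt_of_le_of_ne (hρ0 x) hne.symm)
  have hbint : Integrable (fun z : E × E => S.indicator ρ z.1 * S.indicator (fun _ => M ^ 2 * R) z.2)
      (ν.prod ν) :=
    (hρSint.integrable_indicator hS).mul_prod
      ((integrable_indicator_iff hS).2 (integrableOn_const hSν))
  rw [hcov, ← Real.norm_eq_abs]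
  refine (norm_integral_le_of_norm_le hbint ?_).trans (le_of_eq ?_)
  · filter_upwards [Measure.quasiMeasurePreserving_fst.ae hR'] with z hz
    by_cases h : z.1 ∈ S
    swap
    · simp [h, hzero h]
    by_cases h' : z.2 ∈ S
    swap
    · simp [h', hzero h']
    by_cases hρz : ρ z.1 = 0
    · simp [h, hρz]
    · have hq := hz hρz h z.2 h'
      simp only [h, h', Set.indicator_of_mem, norm_mul, Real.norm_eq_abs, abs_of_nonneg (hρ0 z.1)]
      have h3 : |f z.1| * |f z.2| ≤ M * M := by simpa using hffb z
      calc |f z.1| * |f z.2| * (ρ z.1 * |q z.1 z.2 - ρ z.2|) ≤ M * M * (ρ z.1 * R) :=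
            mul_le_mul h3 (mul_le_mul_of_nonneg_left hq (hρ0 _))
              (mul_nonneg (hρ0 _) (abs_nonneg _)) (mul_self_nonneg M)
        _ = _ := by ring
  · rw [integral_prod_mul, integral_indicator hS, integral_indicator_const _ hS, hρS, smul_eq_mul]
    ring

end Densities

section HeatKernel

lemma mul_psiFun_sq_of_three_le {d : ℕ} (hd : 3 ≤ d) {l : ℝ} (hl : 0 < l) :
    l * psiFun d l ^ 2 = l ^ ((2 : ℝ) / d) := by
  have h1 : d ≠ 1 := by omega
  have h2 : d ≠ 2 := by omega
  rw [psiFun, if_neg h1, if_neg h2, ← Real.rpow_natCast, ← Real.rpow_mul hl.le]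
  nth_rewrite 1 [← Real.rpow_one l]
  rw [← Real.rpow_add hl]
  congr 1
  push_cast
  ring

lemma psiFun_two_sq {l : ℝ} (hl0 : 0 < l) (hl1 : l < 1) :
    psiFun 2 l ^ 2 = 1 + Real.log (1 / l) := by
  have : 0 ≤ Real.log (1 / l) := Real.log_nonneg (by rw [le_div_iff₀ hl0]; linarith)
  rw [psiFun, if_neg (by norm_num), if_pos rfl, Real.sq_sqrt (by linarith)]

lemma one_le_psiFun_sq {d : ℕ} (hd : 1 ≤ d) {l : ℝ} (hl0 : 0 < l) (hl1 : l < 1) :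
    1 ≤ psiFun d l ^ 2 := by
  obtain rfl | rfl | h : d = 1 ∨ d = 2 ∨ 3 ≤ d := by omega
  · simp [psiFun]
  · rw [psiFun_two_sq hl0 hl1]
    have : 0 ≤ Real.log (1 / l) := Real.log_nonneg (by rw [le_div_iff₀ hl0]; linarith)
    linarith
  · have h3 : (3 : ℝ) ≤ d := by exact_mod_cast h
    have hle : l ≤ l ^ ((2 : ℝ) / d) := by
      conv_lhs => rw [← Real.rpow_one l]
      exact Real.rpow_le_rpow_of_exponent_ge hl0 hl1.le (by
        rw [div_le_one (by linarith)]; linarith)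
    rw [← mul_psiFun_sq_of_three_le h hl0] at hle
    exact le_of_mul_le_mul_left (by linarith) hl0

lemma integrableOn_min_one {A : ℝ → ℝ} (hA : Measurable A)
    (hA0 : ∀ t ∈ Set.Ioc (0 : ℝ) 1, 0 ≤ A t) {l : ℝ} (hl : 0 ≤ l) :
    IntegrableOn (fun t => min 1 (l * A t)) (Set.Ioc 0 1) := by
  refine Integrable.of_bound (measurable_const.min (hA.const_mul l)).aestronglyMeasurable 1 ?_
  filter_upwards [ae_restrict_mem measurableSet_Ioc] with t ht
  rw [Real.norm_eq_abs, abs_of_nonneg (le_min zero_le_one (mul_nonneg hl (hA0 t ht)))]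
  exact min_le_left _ _

lemma integral_min_one_le {A : ℝ → ℝ} (hA : Measurable A)
    (hA0 : ∀ t ∈ Set.Ioc (0 : ℝ) 1, 0 ≤ A t) {l : ℝ} (hl : 0 ≤ l) {δ : ℝ} (hδ0 : 0 ≤ δ)
    (hδ1 : δ ≤ 1) (hAint : IntervalIntegrable A volume δ 1) :
    ∫ t in Set.Ioc 0 1, min 1 (l * A t) ≤ δ + l * ∫ t in δ..1, A t := by
  have hint := integrableOn_min_one hA hA0 hl
  have hint' : IntervalIntegrable (fun t => min 1 (l * A t)) volume 0 1 :=
    (intervalIntegrable_iff_integrableOn_Ioc_of_le zero_le_one).2 hint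
  have h₁ : IntervalIntegrable (fun t => min 1 (l * A t)) volume 0 δ :=
    hint'.mono_set (by
      rw [Set.uIcc_of_le hδ0, Set.uIcc_of_le zero_le_one]; exact Set.Icc_subset_Icc_right hδ1)
  have h₂ : IntervalIntegrable (fun t => min 1 (l * A t)) volume δ 1 :=
    hint'.mono_set (by
      rw [Set.uIcc_of_le hδ1, Set.uIcc_of_le zero_le_one]; exact Set.Icc_subset_Icc_left hδ0)
  rw [← intervalIntegral.integral_of_le zero_le_one,
    ← intervalIntegral.integral_add_adjacent_intervals h₁ h₂,
    ← intervalIntegral.integral_const_mul]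
  refine add_le_add ?_ ?_
  · calc ∫ t in (0 : ℝ)..δ, min 1 (l * A t) ≤ ∫ _ in (0 : ℝ)..δ, (1 : ℝ) :=
          intervalIntegral.integral_mono_on hδ0 h₁ intervalIntegrable_const
            fun t _ => min_le_left _ _
      _ = δ := by simp
  · exact intervalIntegral.integral_mono_on hδ1 h₂ (hAint.const_mul l) fun t _ => min_le_right _ _

lemma integral_min_one_inv_le {c : ℝ} (hc : 0 < c) {l : ℝ} (hl0 : 0 < l) (hl1 : l < 1) :
    ∫ t in Set.Ioc (0 : ℝ) 1, min 1 (l * (c * t ^ (-((2 : ℕ) : ℝ) / 2))) ≤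
      (1 + c) * l * psiFun 2 l ^ 2 := by
  have hexp : -((2 : ℕ) : ℝ) / 2 = -1 := by norm_num
  have hlog : 0 ≤ Real.log (1 / l) := Real.log_nonneg (by rw [le_div_iff₀ hl0]; linarith)
  have h0 : (0 : ℝ) ∉ Set.uIcc l 1 := by
    rw [Set.uIcc_of_le hl1.le]
    exact fun h => hl0.not_ge h.1
  simp_rw [hexp, Real.rpow_neg_one]
  refine (integral_min_one_le (by fun_prop) (fun t ht => ?_) hl0.le hl0.le hl1.le ?_).trans ?_
  · exact mul_nonneg hc.le (inv_nonneg.2 ht.1.le)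
  · exact (intervalIntegral.intervalIntegrable_inv (fun x hx => ne_of_mem_of_not_mem hx h0)
      continuousOn_id).const_mul c
  · rw [intervalIntegral.integral_const_mul, integral_inv_of_pos hl0 one_pos,
      psiFun_two_sq hl0 hl1]
    nlinarith [mul_nonneg hl0.le hlog, mul_pos hl0 hc]

lemma integral_min_one_rpow_le {d : ℕ} (hd : 3 ≤ d) {c : ℝ} (hc : 0 < c) {l : ℝ} (hl0 : 0 < l)
    (hl1 : l < 1) :
    ∫ t in Set.Ioc (0 : ℝ) 1, min 1 (l * (c * t ^ (-(d : ℝ) / 2))) ≤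
      (1 + c / ((d : ℝ) / 2 - 1)) * l * psiFun d l ^ 2 := by
  have h3 : (3 : ℝ) ≤ d := by exact_mod_cast hd
  set δ : ℝ := l ^ ((2 : ℝ) / d) with hδ
  have hδ0 : 0 < δ := Real.rpow_pos_of_pos hl0 _
  have hδ1 : δ ≤ 1 := Real.rpow_le_one hl0.le hl1.le (by positivity)
  have h0 : (0 : ℝ) ∉ Set.uIcc δ 1 := by
    rw [Set.uIcc_of_le hδ1]
    exact fun h => hδ0.not_ge h.1
  have hscale : l * δ ^ (-(d : ℝ) / 2 + 1) = δ := by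
    rw [hδ, ← Real.rpow_mul hl0.le]
    nth_rewrite 1 [← Real.rpow_one l]
    rw [← Real.rpow_add hl0]
    congr 1
    field_simp
    ring
  refine (integral_min_one_le (by fun_prop) (fun t ht => ?_) hl0.le hδ0.le hδ1 ?_).trans ?_
  · exact mul_nonneg hc.le (Real.rpow_nonneg ht.1.le _)
  · exact (intervalIntegral.intervalIntegrable_rpow (Or.inr h0)).const_mul c
  · rw [intervalIntegral.integral_const_mul, integral_rpow (Or.inr ⟨by linarith, h0⟩),
      mul_assoc (1 + _), mul_psiFun_sq_of_three_le hd hl0, ← hδ, Real.one_rpow]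
    have hden : 0 < (d : ℝ) / 2 - 1 := by linarith
    have hrw : (1 - δ ^ (-(d : ℝ) / 2 + 1)) / (-(d : ℝ) / 2 + 1) =
        (δ ^ (-(d : ℝ) / 2 + 1) - 1) / ((d : ℝ) / 2 - 1) := by
      rw [div_eq_div_iff (by linarith) hden.ne']
      ring
    have heq : l * (c * ((δ ^ (-(d : ℝ) / 2 + 1) - 1) / ((d : ℝ) / 2 - 1))) =
        c / ((d : ℝ) / 2 - 1) * (l * δ ^ (-(d : ℝ) / 2 + 1) - l) := by ring
    rw [hrw, heq, hscale]
    have := mul_nonneg (div_pos hc hden).le hl0.le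
    linarith

/-- The heat kernel bound in a form uniform in the dimension. -/
lemma exists_integral_min_one_le_of_heat_kernel_bound {E : Type*} [Nonempty E] {d : ℕ} (hd : 1 ≤ d)
    {p : ℝ → E → E → ℝ} (hpnn : ∀ t x y, 0 ≤ p t x y)
    (hheat1 : d = 1 → ∃ a : ℝ → ℝ, Measurable a ∧ (∀ t, 0 ≤ a t) ∧
      (∀ t ∈ Set.Ioc (0 : ℝ) 1, ∀ x y, p t x y ≤ a t) ∧ IntegrableOn a (Set.Ioc 0 1))
    (hheat2 : 2 ≤ d → ∃ c₂ : ℝ, 0 < c₂ ∧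
      ∀ t ∈ Set.Ioc (0 : ℝ) 1, ∀ x y, p t x y ≤ c₂ * t ^ (-(d : ℝ) / 2)) :
    ∃ (A : ℝ → ℝ) (B : ℝ), Measurable A ∧ 0 ≤ B ∧ (∀ t ∈ Set.Ioc (0 : ℝ) 1, 0 ≤ A t) ∧
      (∀ t ∈ Set.Ioc (0 : ℝ) 1, ∀ x y, p t x y ≤ A t) ∧
      ∀ l : ℝ, 0 < l → l < 1 →
        ∫ t in Set.Ioc (0 : ℝ) 1, min 1 (l * A t) ≤ B * l * psiFun d l ^ 2 := by
  have hnn {A : ℝ → ℝ} (h : ∀ t ∈ Set.Ioc (0 : ℝ) 1, ∀ x y, p t x y ≤ A t) :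
      ∀ t ∈ Set.Ioc (0 : ℝ) 1, 0 ≤ A t := fun t ht =>
    (hpnn t (Classical.arbitrary E) (Classical.arbitrary E)).trans (h t ht _ _)
  obtain rfl | h2 : d = 1 ∨ 2 ≤ d := by omega
  · obtain ⟨a, ham, ha0, hpa, haint⟩ := hheat1 rfl
    refine ⟨a, ∫ t in Set.Ioc 0 1, a t, ham, integral_nonneg ha0, fun t _ => ha0 t, hpa,
      fun l hl0 hl1 => ?_⟩
    have := integral_min_one_le ham (fun t _ => ha0 t) hl0.le le_rfl zero_le_one
      ((intervalIntegrable_iff_integrableOn_Ioc_of_le zero_le_one).2 haint)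
    rw [intervalIntegral.integral_of_le zero_le_one] at this
    simp only [psiFun, if_true]
    linarith
  · obtain ⟨c, hc, hpc⟩ := hheat2 h2
    obtain rfl | h3 : d = 2 ∨ 3 ≤ d := by omega
    · exact ⟨_, 1 + c, by fun_prop, by positivity, hnn hpc, hpc,
        fun l hl0 hl1 => integral_min_one_inv_le hc hl0 hl1⟩
    · have hden : 0 < (d : ℝ) / 2 - 1 := by
        have : (3 : ℝ) ≤ d := by exact_mod_cast h3
        linarith
      exact ⟨_, 1 + c / ((d : ℝ) / 2 - 1), by fun_prop, by positivity, hnn hpc, hpc,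
        fun l hl0 hl1 => integral_min_one_rpow_le h3 hc hl0 hl1⟩

end HeatKernel

/-- Variance of an additive functional of a process with stationary density `ρ` and transition
densities `p t`, bounded by `A t` for `t ≤ 1` and `r t`-close to `ρ` on `S` for `t > 1`. -/
lemma variance_additive_functional_le {Ω E : Type*} [MeasurableSpace Ω] {P : Measure Ω}
    [IsProbabilityMeasure P] [MeasurableSpace E] {ν : Measure E} [SFinite ν]
    {X : ℝ → Ω → E} (hX : Measurable (Function.uncurry X))
    {ρ : E → ℝ} (hρ : Measurable ρ) (hρ0 : ∀ x, 0 ≤ ρ x)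
    {μ : Measure E} [IsProbabilityMeasure μ]
    (hμ : μ = ν.withDensity fun x => ENNReal.ofReal (ρ x))
    {p : ℝ → E → E → ℝ} (hp : ∀ t, Measurable (Function.uncurry (p t)))
    (hp0 : ∀ t x y, 0 ≤ p t x y)
    (hlaw : ∀ s : ℝ, 0 ≤ s → P.map (X s) = μ)
    (hpair : ∀ s u : ℝ, 0 ≤ s → s < u → P.map (fun ω => (X s ω, X u ω)) =
      (ν.prod ν).withDensity fun z => ENNReal.ofReal (ρ z.1 * p (u - s) z.1 z.2))
    {A : ℝ → ℝ} (hA : Measurable A) (hA0 : ∀ t ∈ Set.Ioc (0 : ℝ) 1, 0 ≤ A t)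
    (hpA : ∀ t ∈ Set.Ioc (0 : ℝ) 1, ∀ x y, p t x y ≤ A t)
    {S : Set E} (hS : MeasurableSet S) (hSν : ν S ≠ ∞)
    {r : ℝ → ℝ} (hr0 : ∀ t, 0 ≤ r t)
    (hpr : ∀ t : ℝ, 1 < t → ∀ᵐ x ∂μ, x ∈ S → ∀ y ∈ S, |p t x y - ρ y| ≤ r t)
    (hrint : IntegrableOn r (Set.Ioi 1))
    {f : E → ℝ} (hf : Measurable f) (hfS : Function.support f ⊆ S) {M : ℝ}
    (hM : ∀ x, |f x| ≤ M) {T : ℝ} (hT : 0 < T) :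
    Var[fun ω => ∫ t in (0 : ℝ)..T, f (X t ω); P] ≤
      2 * T * (M ^ 2 * μ.real S * ((∫ t in Set.Ioc (0 : ℝ) 1, min 1 (ν.real S * A t)) +
        A 1 * ν.real S + ν.real S * ∫ t in Set.Ioi 1, r t)) := by
  have hXt (t : ℝ) : Measurable (X t) := hX.of_uncurry_left
  have hmass (s : ℝ) (hs : 0 ≤ s) : P.real (X s ⁻¹' S) = μ.real S := by
    rw [← hlaw s hs, map_measureReal_apply (hXt s) hS]
  have hjoint (s u : ℝ) (hs : 0 ≤ s) (hsu : s < u) (hus : u - s ≤ 1) {S₁ : Set E}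
      (hS₁ : MeasurableSet S₁) :
      P.real (X s ⁻¹' S₁ ∩ X u ⁻¹' S) ≤ P.real (X s ⁻¹' S₁) * (ν.real S * A (u - s)) := by
    have hmem : u - s ∈ Set.Ioc (0 : ℝ) 1 := ⟨sub_pos.2 hsu, hus⟩
    have := measure_inter_preimage_le_of_density_le hρ hρ0 (hXt s) (hXt u) (hpair s u hs hsu)
      ((hlaw s hs).trans hμ) (hpA _ hmem) hS₁ hS
    have := ENNReal.toReal_mono (by finiteness) this
    rw [ENNReal.toReal_mul, ENNReal.toReal_mul, ENNReal.toReal_ofReal (hA0 _ hmem)] at this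
    rwa [mul_comm (A _)] at this
  have hμν : μ.real S ≤ A 1 * ν.real S := by
    have := hjoint 0 1 le_rfl zero_lt_one (by norm_num) MeasurableSet.univ
    simpa [hmass 1 zero_le_one, mul_comm] using this
  set m := μ.real S
  set l := ν.real S
  have hm0 : 0 ≤ m := measureReal_nonneg
  have hl0 : 0 ≤ l := measureReal_nonneg
  set k₁ : ℝ → ℝ := fun t => M ^ 2 * (m * min 1 (l * A t) + m * m) with hk₁
  set k₂ : ℝ → ℝ := fun t => M ^ 2 * (m * l * r t) with hk₂
  have hk₁int : IntegrableOn k₁ (Set.Ioc 0 1) :=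
    (((integrableOn_min_one hA hA0 hl0).const_mul m).add
      (integrable_const (m * m))).const_mul (M ^ 2)
  have hk₂int : IntegrableOn k₂ (Set.Ioi 1) := (hrint.const_mul (m * l)).const_mul (M ^ 2)
  have hk₁ind := hk₁int.integrable_indicator measurableSet_Ioc
  have hk₂ind := hk₂int.integrable_indicator measurableSet_Ioi
  set k : ℝ → ℝ := fun t => (Set.Ioc 0 1).indicator k₁ t + (Set.Ioi 1).indicator k₂ t with hk
  have hkint : Integrable k := hk₁ind.add hk₂ind
  have hk0 (t : ℝ) : 0 ≤ k t := by
    refine add_nonneg (Set.indicator_nonneg (fun t ht => ?_) t)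
      (Set.indicator_nonneg (fun t _ => ?_) t)
    · have := le_min zero_le_one (mul_nonneg hl0 (hA0 t ht))
      positivity
    · have := hr0 t
      positivity
  have hcov (s u : ℝ) (hs : 0 ≤ s) (hsu : s < u) :
      |cov[fun ω => f (X s ω), fun ω => f (X u ω); P]| ≤ k (u - s) := by
    have hu : 0 ≤ u := hs.trans hsu.le
    rcases le_or_gt (u - s) 1 with hus | hus
    · have hkval : k (u - s) = k₁ (u - s) := by
        simp [hk, hus, hsu]
      rw [hkval, hk₁]
      refine (abs_covariance_comp_le hf hS hfS hM (hXt s) (hXt u)).trans ?_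
      rw [hmass s hs, hmass u hu]
      refine mul_le_mul_of_nonneg_left (add_le_add_left ?_ _) (sq_nonneg M)
      rw [mul_min_of_nonneg _ _ hm0, mul_one]
      refine le_min ?_ ?_
      · rw [← hmass s hs]
        exact measureReal_mono Set.inter_subset_left
      · simpa [hmass s hs] using hjoint s u hs hsu hus hS
    · have hkval : k (u - s) = k₂ (u - s) := by
        simp [hk, hus, hus.not_ge]
      rw [hkval, hk₂]
      have hR := hpr _ hus
      rw [← hlaw s hs] at hR
      have := abs_covariance_comp_le_of_density_close hρ hρ0 (hp (u - s)) (hp0 _) (hXt s) (hXt u)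
        (hpair s u hs hsu) ((hlaw s hs).trans hμ) ((hlaw u hu).trans hμ) hf hS hSν hfS hM hR
      rwa [hmass s hs] at this
  refine (variance_intervalIntegral_le (Z := fun t ω => f (X t ω)) (hf.comp hX) (fun t ω => hM _) hk0 hkint.integrableOn hcov
    hT).trans ?_
  have hkle : ∫ t in Set.Ioi 0, k t ≤
      (∫ t in Set.Ioc 0 1, k₁ t) + ∫ t in Set.Ioi 1, k₂ t := by
    rw [← integral_indicator (f := k₁) measurableSet_Ioc,
      ← integral_indicator (f := k₂) measurableSet_Ioi, ← integral_add hk₁ind hk₂ind]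
    exact setIntegral_le_integral hkint (.of_forall hk0)
  have hI₁ : ∫ t in Set.Ioc 0 1, k₁ t =
      M ^ 2 * (m * (∫ t in Set.Ioc (0 : ℝ) 1, min 1 (l * A t)) + m * m) := by
    rw [hk₁, integral_const_mul, integral_add ((integrableOn_min_one hA hA0 hl0).const_mul m)
      (integrable_const _), integral_const_mul]
    simp
  have hI₂ : ∫ t in Set.Ioi 1, k₂ t = M ^ 2 * (m * l * ∫ t in Set.Ioi 1, r t) := by
    rw [hk₂, integral_const_mul, integral_const_mul]
  rw [hI₁, hI₂] at hkle
  refine mul_le_mul_of_nonneg_left (hkle.trans ?_) (by positivity)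
  have := mul_le_mul_of_nonneg_left hμν (mul_nonneg (sq_nonneg M) hm0)
  linarith

/-- Variance bound for additive functionals under the heat kernel bound and
the transition density convergence assumption. -/
theorem variance_bound_transition_density_convergence
    (d : ℕ) (hd : 1 ≤ d)
    (Ω : Type*) [MeasureSpace Ω] [IsProbabilityMeasure (ℙ : Measure Ω)]
    (X : ℝ → Ω → (Fin d → ℝ)) (hX : Measurable (Function.uncurry X))
    (ρ : (Fin d → ℝ) → ℝ) (hρmeas : Measurable ρ) (hρnn : ∀ x, 0 ≤ ρ x)
    (μ : Measure (Fin d → ℝ)) [IsProbabilityMeasure μ]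
    (hμρ : μ = volume.withDensity fun x => ENNReal.ofReal (ρ x))
    (p : ℝ → (Fin d → ℝ) → (Fin d → ℝ) → ℝ)
    (hpmeas : Measurable fun q : ℝ × (Fin d → ℝ) × (Fin d → ℝ) => p q.1 q.2.1 q.2.2)
    (hpnn : ∀ t x y, 0 ≤ p t x y)
    (hlaw : ∀ s : ℝ, 0 ≤ s → Measure.map (X s) ℙ = μ)
    (hpair : ∀ s u : ℝ, 0 ≤ s → s < u →
      Measure.map (fun ω => (X s ω, X u ω)) ℙ =
        (volume : Measure ((Fin d → ℝ) × (Fin d → ℝ))).withDensity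
          fun q => ENNReal.ofReal (ρ q.1 * p (u - s) q.1 q.2))
    -- heat kernel bound, case d = 1
    (hheat1 : d = 1 → ∃ a : ℝ → ℝ, Measurable a ∧ (∀ t, 0 ≤ a t) ∧
      (∀ t ∈ Set.Ioc (0 : ℝ) 1, ∀ x y, p t x y ≤ a t) ∧ IntegrableOn a (Set.Ioc 0 1))
    -- heat kernel bound, case d ≥ 2
    (hheat2 : 2 ≤ d → ∃ c₂ : ℝ, 0 < c₂ ∧
      ∀ t ∈ Set.Ioc (0 : ℝ) 1, ∀ x y, p t x y ≤ c₂ * t ^ (-(d : ℝ) / 2))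
    -- transition density convergence assumption
    (Λ : Set (Fin d → ℝ)) (hΛmeas : MeasurableSet Λ) (hΛfull : μ Λ = 1)
    (r : Set (Fin d → ℝ) → ℝ → ℝ)
    (hr : ∀ S : Set (Fin d → ℝ), IsCompact S →
      Measurable (r S) ∧ (∀ t, 0 ≤ r S t) ∧
      (∀ t : ℝ, 1 < t → ∀ x ∈ S ∩ Λ, ∀ y ∈ S, |p t x y - ρ y| ≤ r S t) ∧
      IntegrableOn (r S) (Set.Ioi 1)) :
    ∃ C : ℝ, 0 < C ∧
      ∀ S : Set (Fin d → ℝ), IsCompact S → volume S < 1 →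
      ∀ f : (Fin d → ℝ) → ℝ, Measurable f → Function.support f ⊆ S →
      ∀ M : ℝ, (∀ x, |f x| ≤ M) →
      ∀ T : ℝ, 0 < T →
        variance (fun ω => ∫ t in (0 : ℝ)..T, f (X t ω)) ℙ ≤
          C * max 1 (∫ t in Set.Ioi (1 : ℝ), r S t) * T * M ^ 2 *
            (volume S).toReal * (μ S).toReal * psiFun d (volume S).toReal ^ 2 := by
  obtain ⟨A, B, hA, hB, hA0, hpA, hJ⟩ :=
    exists_integral_min_one_le_of_heat_kernel_bound hd hpnn hheat1 hheat2
  have hK : 0 ≤ A 1 := hA0 1 (by simp)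
  refine ⟨2 * (B + A 1 + 1), by positivity, fun S hScpt hSvol f hf hfS M hM T hT => ?_⟩
  obtain ⟨-, hr0, hpr, hrint⟩ := hr S hScpt
  have hΛae : ∀ᵐ x ∂μ, x ∈ Λ := by
    rw [← mem_ae_iff_prob_eq_one hΛmeas] at hΛfull
    exact hΛfull
  have hvar := variance_additive_functional_le hX hρmeas hρnn hμρ
    (fun t => hpmeas.comp (measurable_prodMk_left (x := t))) hpnn hlaw hpair hA hA0 hpA
    hScpt.measurableSet hScpt.measure_lt_top.ne hr0
    (fun t ht => hΛae.mono fun x hx hxS y hy => hpr t ht x ⟨hxS, hx⟩ y hy) hrint hf hfS hM hT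
  refine hvar.trans ?_
  have hl0 : 0 ≤ (volume S).toReal := ENNReal.toReal_nonneg
  have hl1 : (volume S).toReal < 1 := by
    simpa using (ENNReal.toReal_lt_toReal hScpt.measure_lt_top.ne ENNReal.one_ne_top).2 hSvol
  rw [measureReal_def, measureReal_def]
  rcases hl0.eq_or_lt with hl | hl
  · have hvol : volume S = 0 :=
      ((ENNReal.toReal_eq_zero_iff _).1 hl.symm).resolve_right hScpt.measure_lt_top.ne
    have hμS : μ S = 0 := by
      rw [hμρ]
      exact withDensity_absolutelyContinuous _ _ hvol
    simp [hμS]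
  have hψ := one_le_psiFun_sq hd hl hl1
  have hJl := hJ _ hl hl1
  set l := (volume S).toReal
  set c := ∫ t in Set.Ioi (1 : ℝ), r S t
  have hψl : l ≤ l * psiFun d l ^ 2 := le_mul_of_one_le_right hl.le hψ
  have hψl0 : 0 ≤ l * psiFun d l ^ 2 := hl.le.trans hψl
  have hmax : 0 ≤ max 1 c := zero_le_one.trans (le_max_left _ _)
  have hsum : (∫ t in Set.Ioc (0 : ℝ) 1, min 1 (l * A t)) + A 1 * l + l * c ≤
      (B + A 1 + 1) * max 1 c * (l * psiFun d l ^ 2) := by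
    have h₁ : B * l * psiFun d l ^ 2 + A 1 * l ≤ (B + A 1) * (l * psiFun d l ^ 2) := by
      nlinarith [mul_le_mul_of_nonneg_left hψl hK]
    have h₂ : (B + A 1) * (l * psiFun d l ^ 2) ≤
        max 1 c * ((B + A 1) * (l * psiFun d l ^ 2)) :=
      le_mul_of_one_le_left (mul_nonneg (add_nonneg hB hK) hψl0) (le_max_left _ _)
    have h₃ : l * c ≤ (l * psiFun d l ^ 2) * max 1 c :=
      (mul_le_mul_of_nonneg_left (le_max_right 1 c) hl.le).trans
        (mul_le_mul_of_nonneg_right hψl hmax)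
    linarith
  calc _ ≤ 2 * T * (M ^ 2 * (μ S).toReal * ((B + A 1 + 1) * max 1 c * (l * psiFun d l ^ 2))) := by
        gcongr
    _ = _ := by ring
end

section
/- Assume the stationary-densities setting with the heat kernel bound and the transition density convergence assumption with constants monotone in S (S₁ ⊆ S₂ implies c_{S₁} ≤ c_{S₂}). Let K be a bounded Lipschitz kernel of order ℓ supported in [−1/2,1/2]^d, and let x ∈ ℝ^d be such that there is an open neighbourhood D of x with ρ|_D ∈ H_D(β, L') for some β ∈ (0, ℓ+1] and L' > 0. Define the bandwidth h(T) := T^{−1/γ'} for some fixed γ' ∈ (0, β] if d ≤ 2, and h(T) := T^{−1/(2β+d−2)} if d ≥ 3. Then there exist constants C > 0 and T₀ > 0 such that for all T ≥ T₀: E[(ρ̂_{h(T),T}(x) − ρ(x))²] ≤ C Φ_{d,β}(T)², where Φ_{d,β}(T) := T^{−1/2} if d = 1, (log T/T)^{1/2} if d = 2, and T^{−β/(2β+d−2)} if d ≥ 3. -/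
open MeasureTheory ProbabilityTheory
open scoped ENNReal

/-- Kernel density estimator `ρ̂_{h,T}(x) = (1/T) ∫₀^T h^{-d} K((x − X_s)/h) ds`. -/
noncomputable def kde {d : ℕ} {Ω : Type*} (K : EuclideanSpace ℝ (Fin d) → ℝ)
    (X : ℝ → Ω → EuclideanSpace ℝ (Fin d)) (h T : ℝ) (x : EuclideanSpace ℝ (Fin d))
    (ω : Ω) : ℝ :=
  (1 / T) * ∫ s in (0 : ℝ)..T, (1 / h ^ d) * K (h⁻¹ • (x - X s ω))

/-- Hölder class `H_D(β, L')`: `k`-times continuously differentiable on `D` (where `k` is the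
largest integer strictly smaller than `β`), bounded by `L'`, with `(β−k)`-Hölder continuous
`k`-th derivatives with constant `L'`. -/
def HolderOn {d : ℕ} (D : Set (EuclideanSpace ℝ (Fin d))) (β L' : ℝ) (k : ℕ)
    (f : EuclideanSpace ℝ (Fin d) → ℝ) : Prop :=
  ContDiffOn ℝ k f D ∧ (∀ x ∈ D, |f x| ≤ L') ∧
    ∀ x ∈ D, ∀ y ∈ D,
      ‖iteratedFDerivWithin ℝ k f D x - iteratedFDerivWithin ℝ k f D y‖ ≤
        L' * ‖x - y‖ ^ (β - (k : ℝ))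

/-- A kernel of order `ℓ`: `x ↦ x^α K(x)` is integrable for `|α| ≤ ℓ`, `∫ K = 1`, and all
moments of orders `1,…,ℓ` vanish. -/
def KernelOrder {d : ℕ} (K : EuclideanSpace ℝ (Fin d) → ℝ) (ℓ : ℕ) : Prop :=
  (∀ α : Fin d → ℕ, (∑ i, α i) ≤ ℓ →
    Integrable (fun x : EuclideanSpace ℝ (Fin d) => (∏ i, x i ^ α i) * K x)) ∧
  (∫ x : EuclideanSpace ℝ (Fin d), K x) = 1 ∧
  ∀ α : Fin d → ℕ, 1 ≤ ∑ i, α i → (∑ i, α i) ≤ ℓ →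
    (∫ x : EuclideanSpace ℝ (Fin d), (∏ i, x i ^ α i) * K x) = 0

/-- The rate function `Φ_{d,β}` for the pointwise L² risk. -/
noncomputable def PhiRate (d : ℕ) (β T : ℝ) : ℝ :=
  if d = 1 then T ^ (-(1:ℝ)/2)
  else if d = 2 then Real.sqrt (Real.log T / T)
  else T ^ (-(β / (2 * β + (d:ℝ) - 2)))

/-- Taylor expansion on `[0, 1]` for a chain of successive derivatives. -/
lemma abs_sub_taylor_sum_le {k : ℕ} {B : ℝ} {φ : ℕ → ℝ → ℝ}
    (hφ : ∀ j < k, ∀ t ∈ Set.Icc (0 : ℝ) 1,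
      HasDerivWithinAt (φ j) (φ (j + 1) t) (Set.Icc 0 1) t)
    (hB : ∀ t ∈ Set.Icc (0 : ℝ) 1, |φ k t - φ k 0| ≤ B) {t : ℝ} (ht : t ∈ Set.Icc (0 : ℝ) 1) :
    |φ 0 t - ∑ j ∈ Finset.range (k + 1), t ^ j / (j.factorial : ℝ) * φ j 0| ≤ B := by
  induction k generalizing φ t with
  | zero => simpa using hB t ht
  | succ k ih =>
    have hB0 : 0 ≤ B := (abs_nonneg _).trans (hB t ht)
    have hderiv : ∀ x ∈ Set.Icc (0 : ℝ) 1,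
        HasDerivWithinAt
          (fun x => φ 0 x - ∑ j ∈ Finset.range (k + 2), x ^ j / (j.factorial : ℝ) * φ j 0)
          (φ 1 x - ∑ j ∈ Finset.range (k + 1), x ^ j / (j.factorial : ℝ) * φ (j + 1) 0)
          (Set.Icc 0 1) x := by
      intro x hx
      refine (hφ 0 (Nat.succ_pos k) x hx).sub ?_
      have hterm : ∀ j : ℕ, HasDerivWithinAt
          (fun x : ℝ => x ^ (j + 1) / ((j + 1).factorial : ℝ) * φ (j + 1) 0)
          (x ^ j / (j.factorial : ℝ) * φ (j + 1) 0) (Set.Icc 0 1) x := by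
        intro j
        have h := (((hasDerivAt_pow (j + 1) x).div_const ((j + 1).factorial : ℝ)).mul_const
          (φ (j + 1) 0)).hasDerivWithinAt (s := Set.Icc 0 1)
        refine h.congr_deriv ?_
        have : (j.factorial : ℝ) ≠ 0 := by positivity
        rw [Nat.factorial_succ]
        push_cast
        field_simp
      have hsum := HasDerivWithinAt.fun_sum (u := Finset.range (k + 1)) fun j _ => hterm j
      simp_rw [Finset.sum_range_succ' _ (k + 1)]
      simpa using hsum.add_const (φ 0 0)
    have hbound : ∀ x ∈ Set.Icc (0 : ℝ) 1,
        ‖φ 1 x - ∑ j ∈ Finset.range (k + 1), x ^ j / (j.factorial : ℝ) * φ (j + 1) 0‖ ≤ B :=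
      fun x hx => ih (φ := fun j => φ (j + 1)) (fun j hj => hφ (j + 1) (by omega)) hB hx
    have h := (convex_Icc (0 : ℝ) 1).norm_image_sub_le_of_norm_hasDerivWithin_le hderiv hbound
      (Set.left_mem_Icc.2 zero_le_one) ht
    have hzero : ∑ j ∈ Finset.range (k + 2), (0 : ℝ) ^ j / (j.factorial : ℝ) * φ j 0 = φ 0 0 := by
      rw [Finset.sum_range_succ' _ (k + 1)]
      simp
    rw [hzero, sub_self, sub_zero, sub_zero] at h
    refine h.trans (mul_le_of_le_one_right hB0 ?_)
    rw [Real.norm_eq_abs, abs_le]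
    exact ⟨by linarith [ht.1], ht.2⟩

/-- Multivariate Taylor expansion for functions in a Hölder class. -/
lemma HolderOn.abs_sub_taylor_le {d : ℕ} {D : Set (EuclideanSpace ℝ (Fin d))} {β L' : ℝ} {k : ℕ}
    {f : EuclideanSpace ℝ (Fin d) → ℝ} (hf : HolderOn D β L' k f) (hD : IsOpen D) (hL' : 0 ≤ L')
    (hk : (k : ℝ) < β) {x v : EuclideanSpace ℝ (Fin d)}
    (hseg : ∀ t ∈ Set.Icc (0 : ℝ) 1, x + t • v ∈ D) :
    |f (x + v) - ∑ j ∈ Finset.range (k + 1),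
        ((j.factorial : ℝ)⁻¹ * iteratedFDerivWithin ℝ j f D x fun _ => v)| ≤ L' * ‖v‖ ^ β := by
  have hx : x ∈ D := by simpa using hseg 0 (by simp)
  let φ : ℕ → ℝ → ℝ := fun j t => iteratedFDerivWithin ℝ j f D (x + t • v) fun _ => v
  have hT : HasFTaylorSeriesUpToOn k f (ftaylorSeriesWithin ℝ f D) D :=
    hf.1.ftaylorSeriesWithin hD.uniqueDiffOn
  have hφ : ∀ j < k, ∀ t ∈ Set.Icc (0 : ℝ) 1,
      HasDerivWithinAt (φ j) (φ (j + 1) t) (Set.Icc 0 1) t := by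
    intro j hj t ht
    have h1 := hT.fderivWithin j (by exact_mod_cast hj) (x + t • v) (hseg t ht)
    have hline : HasDerivWithinAt (fun t : ℝ => x + t • v) v (Set.Icc 0 1) t := by
      simpa using (((hasDerivAt_id t).smul_const v).const_add x).hasDerivWithinAt
    have h2 := h1.comp_hasDerivWithinAt t hline hseg
    have h3 := ((ContinuousMultilinearMap.apply ℝ (fun _ : Fin j => EuclideanSpace ℝ (Fin d)) ℝ
      (fun _ => v)).hasFDerivAt).comp_hasDerivWithinAt t h2
    exact h3
  have hB : ∀ t ∈ Set.Icc (0 : ℝ) 1, |φ k t - φ k 0| ≤ L' * ‖v‖ ^ β := by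
    intro t ht
    have h1 := hf.2.2 _ (hseg t ht) _ hx
    have h2 := (iteratedFDerivWithin ℝ k f D (x + t • v) -
      iteratedFDerivWithin ℝ k f D x).le_opNorm fun _ => v
    have hnorm : ‖x + t • v - x‖ ≤ ‖v‖ := by
      rw [add_sub_cancel_left, norm_smul, Real.norm_eq_abs, abs_of_nonneg ht.1]
      exact mul_le_of_le_one_left (norm_nonneg v) ht.2
    have h3 : ‖x + t • v - x‖ ^ (β - k) ≤ ‖v‖ ^ (β - k) :=
      Real.rpow_le_rpow (norm_nonneg _) hnorm (by linarith)
    have h4 : ‖v‖ ^ β = ‖v‖ ^ (β - k) * ‖v‖ ^ k := by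
      rcases eq_or_ne k 0 with rfl | hk0
      · simp
      · rw [← Real.rpow_natCast, ← Real.rpow_add_of_nonneg (norm_nonneg v) (by linarith)
          (Nat.cast_nonneg k), sub_add_cancel]
    rw [Finset.prod_const, Finset.card_univ, Fintype.card_fin] at h2
    simp only [φ, zero_smul, add_zero]
    rw [← Real.norm_eq_abs, h4, ← mul_assoc]
    refine le_trans h2 ?_
    gcongr
    exact h1.trans (by gcongr)
  have h := abs_sub_taylor_sum_le hφ hB (Set.right_mem_Icc.2 zero_le_one)
  simpa [φ] using h

/-- Homogeneous polynomials of degree `1 ≤ j ≤ ℓ` integrate to zero against a kernel of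
order `ℓ`. -/
lemma KernelOrder.integral_multilinear_eq_zero {d : ℕ} {K : EuclideanSpace ℝ (Fin d) → ℝ} {ℓ : ℕ}
    (hK : KernelOrder K ℓ) {j : ℕ} (hjℓ : j ≤ ℓ)
    (A : ContinuousMultilinearMap ℝ (fun _ : Fin j => EuclideanSpace ℝ (Fin d)) ℝ) :
    Integrable (fun z => K z * A fun _ => z) ∧
      (1 ≤ j → ∫ z, K z * A (fun _ => z) = 0) := by
  classical
  have hexp : ∀ z, K z * A (fun _ => z) = ∑ i : Fin j → Fin d,
      A (fun l => EuclideanSpace.single (i l) (1 : ℝ)) *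
        ((∏ m, z m ^ (Finset.univ.filter fun l => i l = m).card) * K z) := by
    intro z
    have hz : ∑ m, z m • EuclideanSpace.single m (1 : ℝ) = z := by
      simpa using (EuclideanSpace.basisFun (Fin d) ℝ).sum_repr z
    conv_lhs => rw [mul_comm, ← hz]
    have hmap := A.toMultilinearMap.map_sum
      fun (_ : Fin j) m => z m • EuclideanSpace.single m (1 : ℝ)
    simp only [ContinuousMultilinearMap.coe_coe] at hmap
    rw [hz] at hmap ⊢
    rw [hmap, Finset.sum_mul]
    refine Finset.sum_congr rfl fun i _ => ?_
    have hsmul := A.toMultilinearMap.map_smul_univ (fun l => z (i l))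
      fun l => EuclideanSpace.single (i l) (1 : ℝ)
    simp only [ContinuousMultilinearMap.coe_coe] at hsmul
    have hprod : ∏ m, z m ^ (Finset.univ.filter fun l => i l = m).card = ∏ l, z (i l) := by
      rw [← Finset.prod_fiberwise' Finset.univ i fun m => z m]
      simp
    rw [hsmul, hprod, smul_eq_mul]
    ring
  have hdeg : ∀ i : Fin j → Fin d,
      ∑ m, (Finset.univ.filter fun l => i l = m).card = j := by
    intro i
    rw [← Finset.card_eq_sum_card_fiberwise (fun _ _ => Finset.mem_coe.2 (Finset.mem_univ _))]
    simp
  have hint : ∀ i : Fin j → Fin d, Integrable fun z : EuclideanSpace ℝ (Fin d) =>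
      A (fun l => EuclideanSpace.single (i l) (1 : ℝ)) *
        ((∏ m, z m ^ (Finset.univ.filter fun l => i l = m).card) * K z) :=
    fun i => (hK.1 _ ((hdeg i).le.trans hjℓ)).const_mul _
  simp_rw [hexp]
  refine ⟨integrable_finsetSum _ fun i _ => hint i, fun hj => ?_⟩
  rw [integral_finsetSum _ fun i _ => hint i]
  refine Finset.sum_eq_zero fun i _ => ?_
  rw [integral_const_mul, hK.2.2 _ (hj.trans (hdeg i).ge) ((hdeg i).le.trans hjℓ), mul_zero]

/-- Order of approximation of a Hölder function by convolution with a kernel of order `ℓ`. -/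
lemma abs_integral_kernel_mul_sub_le {d : ℕ} {D : Set (EuclideanSpace ℝ (Fin d))}
    {β L' : ℝ} {k ℓ : ℕ} {f K : EuclideanSpace ℝ (Fin d) → ℝ} (hf : HolderOn D β L' k f)
    (hD : IsOpen D) (hL' : 0 ≤ L') (hk : (k : ℝ) < β) (hkℓ : k ≤ ℓ) (hK : KernelOrder K ℓ)
    (hfm : Measurable f) {B R h : ℝ} (hKB : ∀ z, K z ≠ 0 → ‖z‖ ≤ B)
    {x : EuclideanSpace ℝ (Fin d)} (hR : Metric.closedBall x R ⊆ D) (hB : 0 ≤ B) (hh : 0 < h)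
    (hhR : h * B ≤ R) :
    |(∫ z, K z * f (x - h • z)) - f x| ≤ (L' * B ^ β * ∫ z, |K z|) * h ^ β := by
  have hβ : 0 < β := lt_of_le_of_lt (Nat.cast_nonneg k) hk
  have hKint : Integrable K := by simpa using hK.1 (fun _ => 0) (by simp)
  let P : EuclideanSpace ℝ (Fin d) → ℝ := fun z => ∑ j ∈ Finset.range (k + 1),
    ((j.factorial : ℝ)⁻¹ * iteratedFDerivWithin ℝ j f D x fun _ => -(h • z))
  have hcoef : ∀ (j : ℕ) (z : EuclideanSpace ℝ (Fin d)),
      K z * ((j.factorial : ℝ)⁻¹ * iteratedFDerivWithin ℝ j f D x fun _ => -(h • z)) =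
        ((j.factorial : ℝ)⁻¹ * (-h) ^ j) *
          (K z * iteratedFDerivWithin ℝ j f D x fun _ => z) := by
    intro j z
    have hs := (iteratedFDerivWithin ℝ j f D x).map_smul_univ (fun _ => -h) fun _ => z
    simp only [neg_smul, Finset.prod_const, Finset.card_univ, Fintype.card_fin, smul_eq_mul] at hs
    rw [hs]
    ring
  have hP : ∀ z, K z * P z = ∑ j ∈ Finset.range (k + 1), ((j.factorial : ℝ)⁻¹ * (-h) ^ j) *
      (K z * iteratedFDerivWithin ℝ j f D x fun _ => z) := fun z => by
    simp only [P, Finset.mul_sum, hcoef]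
  have hterm : ∀ j ∈ Finset.range (k + 1), Integrable fun z =>
      ((j.factorial : ℝ)⁻¹ * (-h) ^ j) * (K z * iteratedFDerivWithin ℝ j f D x fun _ => z) :=
    fun j hj => ((hK.integral_multilinear_eq_zero
      ((Nat.lt_succ_iff.1 (Finset.mem_range.1 hj)).trans hkℓ) _).1).const_mul _
  have hPint : Integrable fun z => K z * P z := by
    simp_rw [hP]
    exact integrable_finsetSum _ hterm
  have hPval : ∫ z, K z * P z = f x := by
    simp_rw [hP]
    rw [integral_finsetSum _ hterm, Finset.sum_range_succ', Finset.sum_eq_zero]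
    · simp [integral_mul_const, hK.2.1]
    · intro j hj
      rw [integral_const_mul, (hK.integral_multilinear_eq_zero
        ((Nat.succ_le_of_lt (Finset.mem_range.1 hj)).trans hkℓ) _).2 (Nat.succ_pos j), mul_zero]
  have hnorm : ∀ z, K z ≠ 0 → ‖-(h • z)‖ ≤ h * B := fun z hz => by
    rw [norm_neg, norm_smul, Real.norm_eq_abs, abs_of_pos hh]
    exact mul_le_mul_of_nonneg_left (hKB z hz) hh.le
  have hseg : ∀ z, K z ≠ 0 → ∀ t ∈ Set.Icc (0 : ℝ) 1, x + t • -(h • z) ∈ D := by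
    intro z hz t ht
    refine hR (Metric.mem_closedBall.2 ?_)
    rw [dist_eq_norm, add_sub_cancel_left, norm_smul, Real.norm_eq_abs, abs_of_nonneg ht.1]
    exact (mul_le_of_le_one_left (norm_nonneg _) ht.2).trans ((hnorm z hz).trans hhR)
  have hfint : Integrable fun z => K z * f (x - h • z) := by
    refine (hKint.abs.mul_const L').mono'
      (hKint.1.mul (hfm.comp (by fun_prop)).aestronglyMeasurable) (.of_forall fun z => ?_)
    by_cases hz : K z = 0
    · simp [hz]
    · rw [norm_mul, Real.norm_eq_abs, Real.norm_eq_abs]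
      refine mul_le_mul_of_nonneg_left (hf.2.1 _ ?_) (abs_nonneg _)
      simpa [sub_eq_add_neg] using hseg z hz 1 (by simp)
  rw [← hPval, ← integral_sub hfint hPint]
  have hle : ∀ z, ‖K z * f (x - h • z) - K z * P z‖ ≤ |K z| * (L' * (h * B) ^ β) := by
    intro z
    by_cases hz : K z = 0
    · simp [hz]
    · rw [← mul_sub, norm_mul, Real.norm_eq_abs, Real.norm_eq_abs]
      refine mul_le_mul_of_nonneg_left ?_ (abs_nonneg _)
      have h1 := hf.abs_sub_taylor_le hD hL' hk (hseg z hz)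
      rw [← sub_eq_add_neg] at h1
      exact h1.trans (by gcongr; exact hnorm z hz)
  have h2 := norm_integral_le_of_norm_le (hKint.abs.mul_const _) (.of_forall hle)
  rw [integral_mul_const, Real.mul_rpow hh.le hB] at h2
  rw [← Real.norm_eq_abs]
  exact h2.trans (le_of_eq (by ring))

/-- Rescaling and reflection of an integral about a point. -/
lemma integral_comp_inv_smul_sub {d : ℕ} (G : EuclideanSpace ℝ (Fin d) → ℝ)
    (x : EuclideanSpace ℝ (Fin d)) {h : ℝ} (hh : 0 < h) :
    ∫ y, 1 / h ^ d * G (h⁻¹ • (x - y)) = ∫ z, G z := by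
  rw [integral_const_mul, integral_sub_left_eq_self (fun y => G (h⁻¹ • y)) volume x,
    Measure.integral_comp_inv_smul_of_nonneg _ _ hh.le]
  simp only [finrank_euclideanSpace, Fintype.card_fin, smul_eq_mul]
  field_simp
lemma integrable_comp_abs_of_integrableOn_Ioi_s9 {b : ℝ → ℝ} (hb : IntegrableOn b (Set.Ioi 0)) :
    Integrable fun t => b |t| := by
  have hpos : IntegrableOn (fun t => b |t|) (Set.Ioi 0) :=
    hb.congr_fun (fun t ht => by rw [abs_of_pos ht]) measurableSet_Ioi
  have hneg : IntegrableOn (fun t => b |t|) (Set.Iic 0) := by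
    have hneg : MeasurableEmbedding fun t : ℝ => -t := (Homeomorph.neg ℝ).measurableEmbedding
    rw [← Measure.map_neg_eq_self (volume : Measure ℝ), hneg.integrableOn_map_iff]
    simp_rw [Function.comp_def, abs_neg, Set.neg_preimage, Set.neg_Iic, neg_zero]
    exact Iff.mpr integrableOn_Ici_iff_integrableOn_Ioi hpos
  rw [← integrableOn_univ, ← Set.Iic_union_Ioi (a := (0 : ℝ))]
  exact hneg.union hpos

/-- Second moment of a time integral in terms of a bound on the covariance function. -/
lemma integral_sq_time_integral_le {Ω E : Type*} [MeasurableSpace Ω] [MeasurableSpace E]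
    {P : Measure Ω} [IsProbabilityMeasure P] {X : ℝ → Ω → E}
    (hX : Measurable (Function.uncurry X)) {g : E → ℝ} (hg : Measurable g) {M : ℝ}
    (hM : ∀ y, |g y| ≤ M) {b : ℝ → ℝ} (hb0 : ∀ t, 0 ≤ b t)
    (hb : IntegrableOn b (Set.Ioi 0))
    (hcov : ∀ s u, 0 ≤ s → s < u → |∫ ω, g (X s ω) * g (X u ω) ∂P| ≤ b (u - s))
    {T : ℝ} (hT : 0 ≤ T) :
    ∫ ω, (∫ s in (0 : ℝ)..T, g (X s ω)) ^ 2 ∂P ≤ 2 * T * ∫ t in Set.Ioi 0, b t := by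
  set ν : Measure ℝ := volume.restrict (Set.Ioc 0 T) with hν
  let Z : Ω × ℝ × ℝ → ℝ := fun q => g (X q.2.1 q.1) * g (X q.2.2 q.1)
  have hZm : Measurable Z :=
    (hg.comp (hX.comp (by fun_prop : Measurable fun q : Ω × ℝ × ℝ => (q.2.1, q.1)))).mul
      (hg.comp (hX.comp (by fun_prop : Measurable fun q : Ω × ℝ × ℝ => (q.2.2, q.1))))
  have hZ : Integrable Z (P.prod (ν.prod ν)) := by
    refine Integrable.of_bound hZm.aestronglyMeasurable (M * M) (.of_forall fun q => ?_)
    rw [norm_mul]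
    exact mul_le_mul (hM _) (hM _) (norm_nonneg _) ((abs_nonneg _).trans (hM (X q.2.1 q.1)))
  have hsq : ∀ ω, (∫ s in (0 : ℝ)..T, g (X s ω)) ^ 2 = ∫ q, Z (ω, q) ∂(ν.prod ν) := by
    intro ω
    rw [intervalIntegral.integral_of_le hT, sq]
    exact (integral_prod_mul (fun s => g (X s ω)) fun s => g (X s ω)).symm
  let F : ℝ × ℝ → ℝ := fun q => ∫ ω, Z (ω, q) ∂P
  have hF : Integrable F (ν.prod ν) := hZ.integral_prod_right
  have hswap : ∫ ω, (∫ s in (0 : ℝ)..T, g (X s ω)) ^ 2 ∂P = ∫ q, F q ∂(ν.prod ν) := by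
    simp_rw [hsq]
    exact integral_integral_swap hZ
  have hFb : ∀ s u, 0 ≤ s → 0 ≤ u → s ≠ u → |F (s, u)| ≤ b |u - s| := by
    intro s u hs hu hsu
    rcases lt_or_gt_of_ne hsu with h | h
    · rw [abs_of_pos (sub_pos.2 h)]
      exact hcov s u hs h
    · rw [abs_sub_comm, abs_of_pos (sub_pos.2 h)]
      have := hcov u s hu h
      simpa only [F, Z, mul_comm] using this
  have hbabs : Integrable fun t => b |t| := integrable_comp_abs_of_integrableOn_Ioi_s9 hb
  have hinner : ∀ s, 0 ≤ s → ∫ u, |F (s, u)| ∂ν ≤ 2 * ∫ t in Set.Ioi 0, b t := by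
    intro s hs
    have hint : Integrable fun u => b |u - s| := hbabs.comp_sub_right s
    calc ∫ u, |F (s, u)| ∂ν ≤ ∫ u, b |u - s| ∂ν := by
          refine integral_mono_of_nonneg (.of_forall fun _ => abs_nonneg _) hint.integrableOn ?_
          filter_upwards [ae_restrict_mem measurableSet_Ioc,
            ae_restrict_of_ae (Measure.ae_ne volume s)] with u hu hus
          exact hFb s u hs hu.1.le hus.symm
      _ ≤ ∫ u, b |u - s| := setIntegral_le_integral hint (.of_forall fun _ => hb0 _)
      _ = 2 * ∫ t in Set.Ioi 0, b t := by
          rw [integral_sub_right_eq_self (fun u => b |u|) s, integral_comp_abs]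
  calc ∫ ω, (∫ s in (0 : ℝ)..T, g (X s ω)) ^ 2 ∂P = ∫ q, F q ∂(ν.prod ν) := hswap
    _ ≤ ∫ q, |F q| ∂(ν.prod ν) := integral_mono hF hF.abs fun q => le_abs_self _
    _ = ∫ s, ∫ u, |F (s, u)| ∂ν ∂ν := integral_prod _ hF.abs
    _ ≤ ∫ s, 2 * (∫ t in Set.Ioi 0, b t) ∂ν := by
        refine integral_mono_of_nonneg (.of_forall fun _ => integral_nonneg fun _ => abs_nonneg _)
          (integrable_const _) ?_
        filter_upwards [ae_restrict_mem measurableSet_Ioc] with s hs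
        exact hinner s hs.1.le
    _ = 2 * T * ∫ t in Set.Ioi 0, b t := by
        rw [integral_const, smul_eq_mul, hν, measureReal_restrict_apply_univ,
          Real.volume_real_Ioc_of_le hT]
        ring

section Covariance

variable {Ω E : Type*} [MeasurableSpace Ω] [MeasurableSpace E] {P : Measure Ω} {ν : Measure E}
  {Y Z : Ω → E} {ρ f : E → ℝ}

lemma integral_comp_of_map_eq_withDensity (hY : Measurable Y) (hρ : Measurable ρ)
    (hρ0 : ∀ y, 0 ≤ ρ y)
    (hlaw : P.map Y = ν.withDensity fun y => ENNReal.ofReal (ρ y)) (hf : Measurable f) :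
    ∫ ω, f (Y ω) ∂P = ∫ y, ρ y * f y ∂ν := by
  rw [← integral_map hY.aemeasurable hf.aestronglyMeasurable, hlaw,
    integral_withDensity_eq_integral_toReal_smul (by fun_prop) (by simp)]
  simp [ENNReal.toReal_ofReal (hρ0 _)]

lemma integrable_density_mul_of_map_eq_withDensity (hY : Measurable Y) (hρ : Measurable ρ)
    (hρ0 : ∀ y, 0 ≤ ρ y)
    (hlaw : P.map Y = ν.withDensity fun y => ENNReal.ofReal (ρ y)) (hf : Measurable f)
    (hint : Integrable (fun ω => f (Y ω)) P) :
    Integrable (fun y => ρ y * f y) ν := by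
  have h := (integrable_map_measure hf.aestronglyMeasurable hY.aemeasurable).2 hint
  rw [hlaw, integrable_withDensity_iff_integrable_smul' (by fun_prop) (by simp)] at h
  simpa [ENNReal.toReal_ofReal (hρ0 _)] using h

lemma integrable_density_mul_sq_and_abs {M L : ℝ} (hρ : Measurable ρ) (hρ0 : ∀ y, 0 ≤ ρ y)
    (hf : Measurable f) (hM : ∀ y, |f y| ≤ M) (hfint : Integrable f ν)
    (hL : ∀ y, f y ≠ 0 → ρ y ≤ L) :
    Integrable (fun y => ρ y * |f y|) ν ∧ (∫ y, ρ y * |f y| ∂ν ≤ L * ∫ y, |f y| ∂ν) ∧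
      (∫ y, ρ y * f y ^ 2 ∂ν ≤ M * L * ∫ y, |f y| ∂ν) := by
  have hle : ∀ y, ρ y * |f y| ≤ L * |f y| := fun y => by
    by_cases h : f y = 0
    · simp [h]
    · exact mul_le_mul_of_nonneg_right (hL y h) (abs_nonneg _)
  have hint : Integrable (fun y => ρ y * |f y|) ν := by
    refine (hfint.abs.const_mul L).mono' (by fun_prop) (.of_forall fun y => ?_)
    rw [Real.norm_eq_abs, abs_of_nonneg (mul_nonneg (hρ0 y) (abs_nonneg _))]
    exact hle y
  refine ⟨hint, ?_, ?_⟩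
  · rw [← integral_const_mul]
    exact integral_mono hint (hfint.abs.const_mul L) hle
  · rw [← integral_const_mul]
    refine integral_mono_of_nonneg (.of_forall fun y => mul_nonneg (hρ0 y) (sq_nonneg _))
      (hfint.abs.const_mul _) (.of_forall fun y => ?_)
    calc ρ y * f y ^ 2 = |f y| * (ρ y * |f y|) := by rw [← sq_abs]; ring
      _ ≤ M * (L * |f y|) := mul_le_mul (hM y) (hle y) (mul_nonneg (hρ0 y) (abs_nonneg _))
          ((abs_nonneg _).trans (hM y))
      _ = M * L * |f y| := by ring

lemma abs_integral_density_mul_le {M L : ℝ} (hρ : Measurable ρ) (hρ0 : ∀ y, 0 ≤ ρ y)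
    (hf : Measurable f) (hM : ∀ y, |f y| ≤ M) (hfint : Integrable f ν)
    (hL : ∀ y, f y ≠ 0 → ρ y ≤ L) :
    |∫ y, ρ y * f y ∂ν| ≤ L * ∫ y, |f y| ∂ν := by
  refine le_trans ?_ (integrable_density_mul_sq_and_abs hρ hρ0 hf hM hfint hL).2.1
  refine abs_integral_le_integral_abs.trans (le_of_eq ?_)
  simp only [abs_mul, abs_of_nonneg (hρ0 _)]

variable [IsProbabilityMeasure P]

lemma integrable_mul_comp {M : ℝ} (hY : Measurable Y) (hZ : Measurable Z) (hf : Measurable f)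
    (hM : ∀ y, |f y| ≤ M) : Integrable (fun ω => f (Y ω) * f (Z ω)) P := by
  refine Integrable.of_bound (by fun_prop) (M * M) (.of_forall fun ω => ?_)
  rw [norm_mul]
  exact mul_le_mul (hM _) (hM _) (norm_nonneg _) ((abs_nonneg _).trans (hM (Y ω)))

/-- Covariance of a bounded function evaluated at two random variables with the same density. -/
lemma integral_centered_mul {M : ℝ} (hY : Measurable Y) (hZ : Measurable Z) (hρ : Measurable ρ)
    (hρ0 : ∀ y, 0 ≤ ρ y)
    (hlawY : P.map Y = ν.withDensity fun y => ENNReal.ofReal (ρ y))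
    (hlawZ : P.map Z = ν.withDensity fun y => ENNReal.ofReal (ρ y))
    (hf : Measurable f) (hM : ∀ y, |f y| ≤ M) :
    ∫ ω, (f (Y ω) - ∫ y, ρ y * f y ∂ν) * (f (Z ω) - ∫ y, ρ y * f y ∂ν) ∂P =
      (∫ ω, f (Y ω) * f (Z ω) ∂P) - (∫ y, ρ y * f y ∂ν) ^ 2 := by
  set m := ∫ y, ρ y * f y ∂ν with hm
  have hYint : Integrable (fun ω => f (Y ω)) P :=
    Integrable.of_bound (hf.comp hY).aestronglyMeasurable M (.of_forall fun ω => hM _)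
  have hZint : Integrable (fun ω => f (Z ω)) P :=
    Integrable.of_bound (hf.comp hZ).aestronglyMeasurable M (.of_forall fun ω => hM _)
  have hYm : ∫ ω, f (Y ω) ∂P = m := integral_comp_of_map_eq_withDensity hY hρ hρ0 hlawY hf
  have hZm : ∫ ω, f (Z ω) ∂P = m := integral_comp_of_map_eq_withDensity hZ hρ hρ0 hlawZ hf
  have hexp : ∀ ω, (f (Y ω) - m) * (f (Z ω) - m) =
      f (Y ω) * f (Z ω) - m * f (Y ω) - m * f (Z ω) + m ^ 2 := fun ω => by ring
  simp_rw [hexp]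
  have hYZ := integrable_mul_comp (P := P) hY hZ hf hM
  have hsub : Integrable (fun ω => f (Y ω) * f (Z ω) - m * f (Y ω)) P :=
    hYZ.sub (hYint.const_mul m)
  have hsub' : Integrable (fun ω => f (Y ω) * f (Z ω) - m * f (Y ω) - m * f (Z ω)) P :=
    hsub.sub (hZint.const_mul m)
  rw [integral_add hsub' (integrable_const _), integral_sub hsub (hZint.const_mul m),
    integral_sub hYZ (hYint.const_mul m), integral_const_mul, integral_const_mul, hYm, hZm,
    integral_const, probReal_univ, one_smul]
  ring

/-- Bound on a product moment through the second moment of the marginals. -/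
lemma abs_integral_mul_le_of_marginals {M L : ℝ} (hY : Measurable Y) (hZ : Measurable Z)
    (hρ : Measurable ρ) (hρ0 : ∀ y, 0 ≤ ρ y)
    (hlawY : P.map Y = ν.withDensity fun y => ENNReal.ofReal (ρ y))
    (hlawZ : P.map Z = ν.withDensity fun y => ENNReal.ofReal (ρ y))
    (hf : Measurable f) (hM : ∀ y, |f y| ≤ M) (hfint : Integrable f ν)
    (hL : ∀ y, f y ≠ 0 → ρ y ≤ L) :
    |∫ ω, f (Y ω) * f (Z ω) ∂P| ≤ M * L * ∫ y, |f y| ∂ν := by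
  have hY2 : Integrable (fun ω => f (Y ω) ^ 2) P := by
    simpa only [sq] using integrable_mul_comp (P := P) hY hY hf hM
  have hZ2 : Integrable (fun ω => f (Z ω) ^ 2) P := by
    simpa only [sq] using integrable_mul_comp (P := P) hZ hZ hf hM
  have h := (integrable_density_mul_sq_and_abs hρ hρ0 hf hM hfint hL).2.2
  calc |∫ ω, f (Y ω) * f (Z ω) ∂P| ≤ ∫ ω, |f (Y ω) * f (Z ω)| ∂P := abs_integral_le_integral_abs
    _ ≤ ∫ ω, (f (Y ω) ^ 2 / 2 + f (Z ω) ^ 2 / 2) ∂P := by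
        refine integral_mono (integrable_mul_comp hY hZ hf hM).abs
          ((hY2.div_const 2).add (hZ2.div_const 2)) fun ω => ?_
        simp only [abs_mul]
        nlinarith [sq_nonneg (|f (Y ω)| - |f (Z ω)|), sq_abs (f (Y ω)), sq_abs (f (Z ω))]
    _ = ∫ y, ρ y * f y ^ 2 ∂ν := by
        rw [integral_add (hY2.div_const 2) (hZ2.div_const 2), integral_div, integral_div,
          integral_comp_of_map_eq_withDensity hY hρ hρ0 hlawY (f := fun y => f y ^ 2)
            (by fun_prop),
          integral_comp_of_map_eq_withDensity hZ hρ hρ0 hlawZ (f := fun y => f y ^ 2)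
            (by fun_prop)]
        ring
    _ ≤ _ := h

variable [SFinite ν] {q : E → E → ℝ}

/-- Bound on a product moment through a bound on the transition density. -/
lemma abs_integral_mul_le_of_transition_le {M L a : ℝ} (hY : Measurable Y) (hZ : Measurable Z)
    (hρ : Measurable ρ) (hρ0 : ∀ y, 0 ≤ ρ y) (hq : Measurable (Function.uncurry q))
    (hq0 : ∀ y z, 0 ≤ q y z)
    (hlaw : P.map (fun ω => (Y ω, Z ω)) =
      (ν.prod ν).withDensity fun r => ENNReal.ofReal (ρ r.1 * q r.1 r.2))
    (hf : Measurable f) (hM : ∀ y, |f y| ≤ M) (hfint : Integrable f ν)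
    (hL : ∀ y, f y ≠ 0 → ρ y ≤ L) (hqa : ∀ y z, q y z ≤ a) :
    |∫ ω, f (Y ω) * f (Z ω) ∂P| ≤ a * (L * (∫ y, |f y| ∂ν) ^ 2) := by
  obtain ⟨hρf, hρfL, -⟩ := integrable_density_mul_sq_and_abs hρ hρ0 hf hM hfint hL
  have hw : Measurable fun r : E × E => ρ r.1 * q r.1 r.2 := by
    exact (hρ.comp measurable_fst).mul hq
  have hw0 : ∀ r : E × E, 0 ≤ ρ r.1 * q r.1 r.2 := fun r => mul_nonneg (hρ0 _) (hq0 _ _)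
  rw [integral_comp_of_map_eq_withDensity (f := fun r : E × E => f r.1 * f r.2) (hY.prodMk hZ) hw
    hw0 hlaw (by fun_prop)]
  have hE : Nonempty E := by
    obtain ⟨ω⟩ := P.nonempty_of_neZero
    exact ⟨Y ω⟩
  have ha : 0 ≤ a := (hq0 hE.some hE.some).trans (hqa _ _)
  calc |∫ r, ρ r.1 * q r.1 r.2 * (f r.1 * f r.2) ∂(ν.prod ν)|
      ≤ ∫ r, a * ((ρ r.1 * |f r.1|) * |f r.2|) ∂(ν.prod ν) := by
        rw [← Real.norm_eq_abs]
        refine norm_integral_le_of_norm_le ((hρf.mul_prod hfint.abs).const_mul a)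
          (.of_forall fun r => ?_)
        rw [Real.norm_eq_abs, abs_mul (ρ r.1 * q r.1 r.2), abs_mul (f r.1), abs_of_nonneg (hw0 r)]
        calc ρ r.1 * q r.1 r.2 * (|f r.1| * |f r.2|)
            = q r.1 r.2 * (ρ r.1 * |f r.1| * |f r.2|) := by ring
          _ ≤ a * (ρ r.1 * |f r.1| * |f r.2|) :=
            mul_le_mul_of_nonneg_right (hqa _ _)
              (mul_nonneg (mul_nonneg (hρ0 _) (abs_nonneg _)) (abs_nonneg _))
    _ = a * ((∫ y, ρ y * |f y| ∂ν) * ∫ y, |f y| ∂ν) := by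
        rw [integral_const_mul, integral_prod_mul (fun y => ρ y * |f y|) fun y => |f y|]
    _ ≤ a * (L * (∫ y, |f y| ∂ν) ^ 2) := by
        rw [sq, ← mul_assoc L]
        exact mul_le_mul_of_nonneg_left (mul_le_mul_of_nonneg_right hρfL
          (integral_nonneg fun _ => abs_nonneg _)) ha

/-- Bound on a covariance through the distance of the transition density to equilibrium. -/
lemma abs_integral_mul_sub_sq_le {M L c : ℝ} {S Λ : Set E} (hY : Measurable Y) (hZ : Measurable Z)
    (hρ : Measurable ρ) (hρ0 : ∀ y, 0 ≤ ρ y) (hq : Measurable (Function.uncurry q))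
    (hq0 : ∀ y z, 0 ≤ q y z)
    (hlaw : P.map (fun ω => (Y ω, Z ω)) =
      (ν.prod ν).withDensity fun r => ENNReal.ofReal (ρ r.1 * q r.1 r.2))
    (hf : Measurable f) (hM : ∀ y, |f y| ≤ M) (hfint : Integrable f ν)
    (hL : ∀ y, f y ≠ 0 → ρ y ≤ L) (hfS : ∀ y, f y ≠ 0 → y ∈ S)
    (hΛ : ∀ᵐ y ∂(ν.withDensity fun y => ENNReal.ofReal (ρ y)), y ∈ Λ) (hc : 0 ≤ c)
    (hqc : ∀ y ∈ S ∩ Λ, ∀ z ∈ S, |q y z - ρ z| ≤ c) :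
    |(∫ ω, f (Y ω) * f (Z ω) ∂P) - (∫ y, ρ y * f y ∂ν) ^ 2| ≤
      c * (L * (∫ y, |f y| ∂ν) ^ 2) := by
  obtain ⟨hρf, hρfL, -⟩ := integrable_density_mul_sq_and_abs hρ hρ0 hf hM hfint hL
  have hw : Measurable fun r : E × E => ρ r.1 * q r.1 r.2 := by
    exact (hρ.comp measurable_fst).mul hq
  have hw0 : ∀ r : E × E, 0 ≤ ρ r.1 * q r.1 r.2 := fun r => mul_nonneg (hρ0 _) (hq0 _ _)
  have hff : Measurable fun r : E × E => f r.1 * f r.2 := by fun_prop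
  have hρf' : Integrable (fun y => ρ y * f y) ν := by
    refine hρf.mono' (by fun_prop) (.of_forall fun y => ?_)
    rw [norm_mul, Real.norm_eq_abs, Real.norm_eq_abs, abs_of_nonneg (hρ0 y)]
  have hint := integrable_density_mul_of_map_eq_withDensity (f := fun r : E × E => f r.1 * f r.2)
    (hY.prodMk hZ) hw hw0 hlaw hff (integrable_mul_comp (P := P) hY hZ hf hM)
  have hΛ' : ∀ᵐ r ∂(ν.prod ν), ρ r.1 ≠ 0 → r.1 ∈ Λ := by
    have h := (ae_withDensity_iff (by fun_prop)).1 hΛ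
    refine Measure.quasiMeasurePreserving_fst.ae (p := fun y => ρ y ≠ 0 → y ∈ Λ) ?_
    filter_upwards [h] with y hy hy0
    exact hy (by simpa using lt_of_le_of_ne (hρ0 y) hy0.symm)
  rw [integral_comp_of_map_eq_withDensity (f := fun r : E × E => f r.1 * f r.2) (hY.prodMk hZ) hw
    hw0 hlaw hff, sq, ← integral_prod_mul (fun y => ρ y * f y) fun y => ρ y * f y,
    ← integral_sub hint (hρf'.mul_prod hρf')]
  calc |∫ r, (ρ r.1 * q r.1 r.2 * (f r.1 * f r.2) - ρ r.1 * f r.1 * (ρ r.2 * f r.2)) ∂(ν.prod ν)|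
      ≤ ∫ r, c * ((ρ r.1 * |f r.1|) * |f r.2|) ∂(ν.prod ν) := by
        rw [← Real.norm_eq_abs]
        refine norm_integral_le_of_norm_le ((hρf.mul_prod hfint.abs).const_mul c) ?_
        filter_upwards [hΛ'] with r hr
        have heq : ρ r.1 * q r.1 r.2 * (f r.1 * f r.2) - ρ r.1 * f r.1 * (ρ r.2 * f r.2) =
            (q r.1 r.2 - ρ r.2) * (ρ r.1 * f r.1 * f r.2) := by ring
        rw [heq, Real.norm_eq_abs, abs_mul, abs_mul, abs_mul, abs_of_nonneg (hρ0 r.1)]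
        by_cases h1 : f r.1 = 0
        · simp [h1]
        by_cases h2 : f r.2 = 0
        · simp [h2]
        by_cases h3 : ρ r.1 = 0
        · simp [h3]
        exact mul_le_mul_of_nonneg_right (hqc _ ⟨hfS _ h1, hr h3⟩ _ (hfS _ h2))
          (mul_nonneg (mul_nonneg (hρ0 _) (abs_nonneg _)) (abs_nonneg _))
    _ = c * ((∫ y, ρ y * |f y| ∂ν) * ∫ y, |f y| ∂ν) := by
        rw [integral_const_mul, integral_prod_mul (fun y => ρ y * |f y|) fun y => |f y|]
    _ ≤ c * (L * (∫ y, |f y| ∂ν) ^ 2) := by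
        rw [sq, ← mul_assoc L]
        exact mul_le_mul_of_nonneg_left (mul_le_mul_of_nonneg_right hρfL
          (integral_nonneg fun _ => abs_nonneg _)) hc

end Covariance

/-- Mean squared error of a time average of a stationary process with transition densities, given
a bound `e` on the product moments at time lags at most one. -/
lemma lintegral_sq_time_average_sub_le {Ω E : Type*} [MeasurableSpace Ω] [MeasurableSpace E]
    {P : Measure Ω} [IsProbabilityMeasure P] {ν : Measure E} [SFinite ν] {X : ℝ → Ω → E}
    (hX : Measurable (Function.uncurry X)) {ρ f : E → ℝ} (hρ : Measurable ρ)
    (hρ0 : ∀ y, 0 ≤ ρ y) {p : ℝ → E → E → ℝ} (hp : ∀ t, Measurable (Function.uncurry (p t)))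
    (hp0 : ∀ t y z, 0 ≤ p t y z)
    (hlaw : ∀ s, 0 ≤ s → P.map (X s) = ν.withDensity fun y => ENNReal.ofReal (ρ y))
    (hpair : ∀ s u, 0 ≤ s → s < u → P.map (fun ω => (X s ω, X u ω)) =
      (ν.prod ν).withDensity fun q => ENNReal.ofReal (ρ q.1 * p (u - s) q.1 q.2))
    {M L : ℝ} (hf : Measurable f) (hM : ∀ y, |f y| ≤ M) (hfint : Integrable f ν)
    (hL : ∀ y, f y ≠ 0 → ρ y ≤ L) (hL0 : 0 ≤ L) {S Λ : Set E} (hfS : ∀ y, f y ≠ 0 → y ∈ S)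
    (hΛ : ∀ᵐ y ∂(ν.withDensity fun y => ENNReal.ofReal (ρ y)), y ∈ Λ) {r e : ℝ → ℝ}
    (hr0 : ∀ t, 0 ≤ r t) (hrint : IntegrableOn r (Set.Ioi 1))
    (hpr : ∀ t, 1 < t → ∀ y ∈ S ∩ Λ, ∀ z ∈ S, |p t y z - ρ z| ≤ r t)
    (he0 : ∀ t, 0 ≤ e t) (heint : IntegrableOn e (Set.Ioc 0 1))
    (he : ∀ s u, 0 ≤ s → s < u → u - s ≤ 1 → |∫ ω, f (X s ω) * f (X u ω) ∂P| ≤ e (u - s))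
    {T : ℝ} (hT : 0 < T) (c : ℝ) :
    ∫⁻ ω, ENNReal.ofReal (((1 / T) * (∫ s in (0 : ℝ)..T, f (X s ω)) - c) ^ 2) ∂P ≤
      ENNReal.ofReal (4 / T * ((∫ t in Set.Ioc 0 1, e t) + ((L * ∫ y, |f y| ∂ν) ^ 2 +
        L * (∫ y, |f y| ∂ν) ^ 2 * ∫ t in Set.Ioi 1, r t)) +
          2 * ((∫ y, ρ y * f y ∂ν) - c) ^ 2) := by
  set m := ∫ y, ρ y * f y ∂ν with hm
  set A := ∫ y, |f y| ∂ν with hA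
  have hXs : ∀ s, Measurable (X s) := fun s => hX.comp measurable_prodMk_left
  have hmA : |m| ≤ L * A := abs_integral_density_mul_le hρ hρ0 hf hM hfint hL
  let b : ℝ → ℝ := fun t => if t ≤ 1 then e t + (L * A) ^ 2 else L * A ^ 2 * r t
  have hb0 : ∀ t, 0 ≤ b t := fun t => by
    dsimp only [b]
    split_ifs
    · exact add_nonneg (he0 t) (sq_nonneg _)
    · exact mul_nonneg (mul_nonneg hL0 (sq_nonneg _)) (hr0 t)
  have hb1 : Set.EqOn (fun t => e t + (L * A) ^ 2) b (Set.Ioc 0 1) := fun t ht =>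
    (if_pos ht.2).symm
  have hb2 : Set.EqOn (fun t => L * A ^ 2 * r t) b (Set.Ioi 1) := fun t ht =>
    (if_neg (not_le.2 ht)).symm
  have hconst : IntegrableOn (fun _ : ℝ => (L * A) ^ 2) (Set.Ioc 0 1) :=
    integrableOn_const (by simp)
  have hbint1 : IntegrableOn b (Set.Ioc 0 1) :=
    (heint.add hconst).congr_fun hb1 measurableSet_Ioc
  have hbint2 : IntegrableOn b (Set.Ioi 1) :=
    IntegrableOn.congr_fun (hrint.const_mul (L * A ^ 2)) hb2 measurableSet_Ioi
  have hunion : Set.Ioc (0 : ℝ) 1 ∪ Set.Ioi 1 = Set.Ioi 0 :=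
    Set.Ioc_union_Ioi_eq_Ioi zero_le_one
  have hbint : IntegrableOn b (Set.Ioi 0) := hunion ▸ hbint1.union hbint2
  have hbval : ∫ t in Set.Ioi 0, b t =
      (∫ t in Set.Ioc 0 1, e t) + ((L * A) ^ 2 + L * A ^ 2 * ∫ t in Set.Ioi 1, r t) := by
    rw [← hunion, setIntegral_union (Set.Ioc_disjoint_Ioi le_rfl) measurableSet_Ioi hbint1 hbint2,
      ← setIntegral_congr_fun measurableSet_Ioc hb1, ← setIntegral_congr_fun measurableSet_Ioi hb2,
      integral_add heint hconst, integral_const_mul]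
    simp [add_assoc]
  have hcov : ∀ s u, 0 ≤ s → s < u →
      |∫ ω, (f (X s ω) - m) * (f (X u ω) - m) ∂P| ≤ b (u - s) := by
    intro s u hs hsu
    have hu : 0 ≤ u := hs.trans hsu.le
    rw [integral_centered_mul (hXs s) (hXs u) hρ hρ0 (hlaw s hs) (hlaw u hu) hf hM]
    by_cases h1 : u - s ≤ 1
    · simp only [b, if_pos h1]
      refine (abs_sub _ _).trans (add_le_add (he s u hs hsu h1) ?_)
      rw [abs_of_nonneg (sq_nonneg _), ← sq_abs]
      exact pow_le_pow_left₀ (abs_nonneg _) hmA 2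
    · simp only [b, if_neg h1]
      rw [mul_comm _ (r (u - s))]
      exact abs_integral_mul_sub_sq_le (hXs s) (hXs u) hρ hρ0 (hp _) (hp0 _) (hpair s u hs hsu)
        hf hM hfint hL hfS hΛ (hr0 _) (hpr _ (not_le.1 h1))
  have hfX : Measurable fun q : Ω × ℝ => f (X q.2 q.1) := hf.comp (hX.comp measurable_swap)
  let I : Ω → ℝ := fun ω => ∫ s in (0 : ℝ)..T, f (X s ω)
  have hIm : Measurable I := by
    simp only [I, intervalIntegral.integral_of_le hT.le]
    exact (hfX.stronglyMeasurable.integral_prod_right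
      (ν := volume.restrict (Set.Ioc 0 T))).measurable
  have hIb : ∀ ω, |I ω| ≤ M * T := fun ω => by
    have h := intervalIntegral.norm_integral_le_of_norm_le_const (a := 0) (b := T)
      (f := fun s => f (X s ω)) (C := M) fun s _ => hM _
    rwa [sub_zero, abs_of_pos hT] at h
  have hsqint : ∀ c : ℝ, Integrable (fun ω => ((1 / T) * I ω - c) ^ 2) P := fun c => by
    refine Integrable.of_bound (by fun_prop) ((M + |c|) ^ 2) (.of_forall fun ω => ?_)
    rw [norm_pow, Real.norm_eq_abs]
    refine pow_le_pow_left₀ (abs_nonneg _) ((abs_sub _ _).trans (add_le_add_left ?_ _)) 2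
    rw [abs_mul, abs_of_pos (one_div_pos.2 hT), one_div, inv_mul_le_iff₀ hT, mul_comm T]
    exact hIb ω
  have hvar : ∫ ω, ((1 / T) * I ω - m) ^ 2 ∂P ≤ 2 / T * ∫ t in Set.Ioi 0, b t := by
    have h := integral_sq_time_integral_le (P := P) hX (hf.sub_const m) (M := M + |m|)
      (fun y => (abs_sub _ _).trans (add_le_add_left (hM y) _)) hb0 hbint hcov hT.le
    have heq : ∀ ω, ((1 / T) * I ω - m) ^ 2 =
        (1 / T) ^ 2 * (∫ s in (0 : ℝ)..T, (f (X s ω) - m)) ^ 2 := by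
      intro ω
      have hi : IntervalIntegrable (fun s => f (X s ω)) volume 0 T := by
        rw [intervalIntegrable_iff_integrableOn_Ioc_of_le hT.le]
        exact Integrable.of_bound
          (hfX.comp measurable_prodMk_left).aestronglyMeasurable M (.of_forall fun s => hM _)
      rw [intervalIntegral.integral_sub hi intervalIntegrable_const,
        intervalIntegral.integral_const, smul_eq_mul, sub_zero, ← mul_pow]
      congr 1
      simp only [I]
      field_simp
    simp_rw [heq]
    rw [integral_const_mul]
    refine (mul_le_mul_of_nonneg_left h (sq_nonneg _)).trans (le_of_eq ?_)
    field_simp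
  rw [← ofReal_integral_eq_lintegral_ofReal (hsqint c) (.of_forall fun _ => sq_nonneg _)]
  refine ENNReal.ofReal_le_ofReal ?_
  rw [← hbval]
  calc ∫ ω, ((1 / T) * I ω - c) ^ 2 ∂P
      ≤ ∫ ω, (2 * ((1 / T) * I ω - m) ^ 2 + 2 * (m - c) ^ 2) ∂P := by
        refine integral_mono (hsqint c) (((hsqint m).const_mul 2).add (integrable_const _))
          fun ω => ?_
        dsimp only
        nlinarith [sq_nonneg ((1 / T) * I ω - m - (m - c))]
    _ = 2 * (∫ ω, ((1 / T) * I ω - m) ^ 2 ∂P) + 2 * (m - c) ^ 2 := by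
        rw [integral_add ((hsqint m).const_mul 2) (integrable_const _), integral_const_mul]
        simp
    _ ≤ 4 / T * (∫ t in Set.Ioi 0, b t) + 2 * (m - c) ^ 2 := by
        have : 2 * (2 / T * ∫ t in Set.Ioi 0, b t) = 4 / T * ∫ t in Set.Ioi 0, b t := by ring
        linarith

/-- Integral of the short time bound `a h⁻ᵈ` for `t ≤ h²` and `b t^{-d/2}` for
`t > h²`. -/
lemma setIntegral_short_time_le {d : ℕ} (hd : 2 ≤ d) {a b h : ℝ} (hb : 0 ≤ b)
    (hh : 0 < h) (hh1 : h ≤ 1) :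
    IntegrableOn (fun t => if t ≤ h ^ 2 then a * (1 / h ^ d) else b * t ^ (-(d : ℝ) / 2))
        (Set.Ioc 0 1) ∧
      ∫ t in Set.Ioc 0 1, (if t ≤ h ^ 2 then a * (1 / h ^ d) else b * t ^ (-(d : ℝ) / 2)) ≤
        if d = 2 then a + 2 * b * -Real.log h else (a + 2 * b) * h ^ (2 - (d : ℝ)) := by
  have hh2 : 0 < h ^ 2 := by positivity
  have hh21 : h ^ 2 ≤ 1 := pow_le_one₀ hh.le hh1
  have e1 : Set.EqOn (fun _ => a * (1 / h ^ d))
      (fun t : ℝ => if t ≤ h ^ 2 then a * (1 / h ^ d) else b * t ^ (-(d : ℝ) / 2))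
      (Set.Ioc 0 (h ^ 2)) := fun t ht => (if_pos ht.2).symm
  have e2 : Set.EqOn (fun t : ℝ => b * t ^ (-(d : ℝ) / 2))
      (fun t : ℝ => if t ≤ h ^ 2 then a * (1 / h ^ d) else b * t ^ (-(d : ℝ) / 2))
      (Set.Ioc (h ^ 2) 1) := fun t ht => (if_neg (not_le.2 ht.1)).symm
  have hnot : (0 : ℝ) ∉ Set.uIcc (h ^ 2) 1 := by
    rw [Set.uIcc_of_le hh21]
    exact fun h0 => absurd h0.1 (not_le.2 hh2)
  have i0 : IntegrableOn (fun t : ℝ => b * t ^ (-(d : ℝ) / 2)) (Set.Ioc (h ^ 2) 1) :=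
    ((intervalIntegrable_iff_integrableOn_Ioc_of_le hh21).1
      (intervalIntegral.intervalIntegrable_rpow (Or.inr hnot))).const_mul b
  have i1 := (integrableOn_const (C := a * (1 / h ^ d)) (μ := volume) (s := Set.Ioc 0 (h ^ 2))
    (by simp)).congr_fun e1 measurableSet_Ioc
  have i2 := i0.congr_fun e2 measurableSet_Ioc
  rw [← Set.Ioc_union_Ioc_eq_Ioc hh2.le hh21]
  refine ⟨i1.union i2, ?_⟩
  rw [setIntegral_union (Set.Ioc_disjoint_Ioc_of_le le_rfl) measurableSet_Ioc i1 i2,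
    ← setIntegral_congr_fun measurableSet_Ioc e1, ← setIntegral_congr_fun measurableSet_Ioc e2,
    setIntegral_const, Real.volume_real_Ioc_of_le hh2.le, integral_const_mul,
    ← intervalIntegral.integral_of_le hh21, smul_eq_mul, sub_zero]
  split_ifs with h2
  · subst h2
    have hinv : ∀ t : ℝ, t ^ (-((2 : ℕ) : ℝ) / 2) = t⁻¹ := fun t => by
      rw [← Real.rpow_neg_one]; norm_num
    simp_rw [hinv]
    rw [integral_inv hnot, Real.log_div one_ne_zero hh2.ne', Real.log_one, Real.log_pow]
    refine le_of_eq ?_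
    push_cast
    field_simp
    ring
  · have hd3 : (3 : ℝ) ≤ d := by exact_mod_cast (by omega : 3 ≤ d)
    have hpow : h ^ 2 * (a * (1 / h ^ d)) = a * h ^ (2 - (d : ℝ)) := by
      rw [Real.rpow_sub hh, Real.rpow_natCast]
      norm_num
      ring
    have hsq : (h ^ 2) ^ (-(d : ℝ) / 2 + 1) = h ^ (2 - (d : ℝ)) := by
      rw [← Real.rpow_natCast h 2, ← Real.rpow_mul hh.le]
      congr 1
      push_cast
      ring
    have hint : ∫ t in (h ^ 2)..1, t ^ (-(d : ℝ) / 2) ≤ 2 * h ^ (2 - (d : ℝ)) := by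
      rw [integral_rpow (Or.inr ⟨by linarith, hnot⟩), hsq, Real.one_rpow,
        div_le_iff_of_neg (by linarith)]
      have := Real.rpow_pos_of_pos hh (2 - (d : ℝ))
      nlinarith
    rw [hpow]
    nlinarith [mul_le_mul_of_nonneg_left hint hb]

lemma kde_rate_of_le_two {d : ℕ} (hd : d = 1 ∨ d = 2) {β γ T I a b Q c : ℝ} (hγ : 0 < γ)
    (hγβ : γ ≤ β) (hI : 0 ≤ I) (ha : 0 ≤ a) (hb : 0 ≤ b) (hQ : 0 ≤ Q) (hT : Real.exp 1 ≤ T) :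
    4 / T * ((if d = 1 then I else a + 2 * b * -Real.log (T ^ (-(1 : ℝ) / γ))) + Q) +
        2 * (c * (T ^ (-(1 : ℝ) / γ)) ^ β) ^ 2 ≤
      (4 * (I + a + 2 * b * γ⁻¹ + Q) + 2 * c ^ 2) * PhiRate d β T ^ 2 := by
  have hT0 : 0 < T := (Real.exp_pos 1).trans_le hT
  have hT1 : 1 ≤ T := (Real.one_le_exp zero_le_one).trans hT
  have hlog : 1 ≤ Real.log T := by rwa [Real.le_log_iff_exp_le hT0]
  have hγ' : 0 ≤ γ⁻¹ := (inv_pos.2 hγ).le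
  have hbias : ((T ^ (-(1 : ℝ) / γ)) ^ β) ^ 2 ≤ T⁻¹ := by
    rw [← Real.rpow_mul hT0.le, ← Real.rpow_natCast, ← Real.rpow_mul hT0.le, ← Real.rpow_neg_one]
    refine Real.rpow_le_rpow_of_exponent_le hT1 ?_
    have h1 : 1 ≤ β / γ := (one_le_div hγ).2 hγβ
    have h2 : -(1 : ℝ) / γ * β * ((2 : ℕ) : ℝ) = -(2 * (β / γ)) := by push_cast; ring
    rw [h2]
    linarith
  have hbias' : 2 * (c * (T ^ (-(1 : ℝ) / γ)) ^ β) ^ 2 ≤ 2 * c ^ 2 * T⁻¹ := by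
    rw [mul_pow, ← mul_assoc]
    exact mul_le_mul_of_nonneg_left hbias (by positivity)
  have hbγ : 0 ≤ 2 * b * γ⁻¹ := by positivity
  have hinv : 0 < T⁻¹ := inv_pos.2 hT0
  rcases hd with rfl | rfl
  · have hPhi : PhiRate 1 β T ^ 2 = T⁻¹ := by
      rw [PhiRate, if_pos rfl, ← Real.rpow_natCast, ← Real.rpow_mul hT0.le, ← Real.rpow_neg_one]
      norm_num
    rw [hPhi, if_pos rfl, div_eq_mul_inv]
    nlinarith [mul_nonneg ha hinv.le, mul_nonneg hbγ hinv.le]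
  · have hPhi : PhiRate 2 β T ^ 2 = T⁻¹ * Real.log T := by
      rw [PhiRate, if_neg (by norm_num), if_pos rfl, Real.sq_sqrt (by positivity), div_eq_inv_mul]
    have hlogh : 2 * b * -Real.log (T ^ (-(1 : ℝ) / γ)) = 2 * b * γ⁻¹ * Real.log T := by
      rw [Real.log_rpow hT0]
      ring
    rw [hPhi, if_neg (by norm_num), hlogh]
    have hvar : a + 2 * b * γ⁻¹ * Real.log T + Q ≤
        (I + a + 2 * b * γ⁻¹ + Q) * Real.log T := by
      nlinarith [mul_nonneg hI (zero_le_one.trans hlog),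
        mul_le_mul_of_nonneg_left hlog (add_nonneg ha hQ)]
    have h1 : 4 / T * (a + 2 * b * γ⁻¹ * Real.log T + Q) ≤
        4 / T * ((I + a + 2 * b * γ⁻¹ + Q) * Real.log T) :=
      mul_le_mul_of_nonneg_left hvar (by positivity)
    have h2 : 2 * c ^ 2 * T⁻¹ ≤ 2 * c ^ 2 * (T⁻¹ * Real.log T) :=
      mul_le_mul_of_nonneg_left (le_mul_of_one_le_right hinv.le hlog) (by positivity)
    rw [div_eq_mul_inv] at h1 ⊢
    linarith

lemma kde_rate_of_three_le {d : ℕ} (hd : 3 ≤ d) {β T a Q c : ℝ} (hβ : 0 < β) (hQ : 0 ≤ Q)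
    (hT : 1 ≤ T) :
    4 / T * (a * (T ^ (-(1 : ℝ) / (2 * β + (d : ℝ) - 2))) ^ (2 - (d : ℝ)) + Q) +
        2 * (c * (T ^ (-(1 : ℝ) / (2 * β + (d : ℝ) - 2))) ^ β) ^ 2 ≤
      (4 * (a + Q) + 2 * c ^ 2) * PhiRate d β T ^ 2 := by
  have hT0 : 0 < T := zero_lt_one.trans_le hT
  have hd3 : (3 : ℝ) ≤ d := by exact_mod_cast hd
  have hden : 0 < 2 * β + (d : ℝ) - 2 := by linarith
  set h := T ^ (-(1 : ℝ) / (2 * β + (d : ℝ) - 2)) with hh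
  have hPhi : PhiRate d β T ^ 2 = (h ^ β) ^ 2 := by
    rw [PhiRate, if_neg (by omega), if_neg (by omega), hh, ← Real.rpow_mul hT0.le]
    ring_nf
  have hvar : T⁻¹ * h ^ (2 - (d : ℝ)) = (h ^ β) ^ 2 := by
    rw [hh, ← Real.rpow_mul hT0.le, ← Real.rpow_mul hT0.le, ← Real.rpow_neg_one,
      ← Real.rpow_add hT0, ← Real.rpow_natCast, ← Real.rpow_mul hT0.le]
    congr 1
    push_cast
    field_simp
    ring
  have hone : T⁻¹ ≤ T⁻¹ * h ^ (2 - (d : ℝ)) := by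
    refine le_mul_of_one_le_right (inv_pos.2 hT0).le ?_
    rw [hh, ← Real.rpow_mul hT0.le]
    refine Real.one_le_rpow hT (mul_nonneg_of_nonpos_of_nonpos ?_ (by linarith))
    exact div_nonpos_of_nonpos_of_nonneg (by norm_num) hden.le
  rw [hPhi, ← hvar, mul_pow, ← hvar, div_eq_mul_inv]
  nlinarith [mul_le_mul_of_nonneg_left hone hQ]

lemma eventually_bandwidth_le {κ δ : ℝ} (hκ : 0 < κ) (hδ : 0 < δ) :
    ∀ᶠ T : ℝ in Filter.atTop, 0 < T ^ (-(1 : ℝ) / κ) ∧ T ^ (-(1 : ℝ) / κ) ≤ δ := by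
  have h := tendsto_rpow_neg_atTop (inv_pos.2 hκ)
  filter_upwards [h.eventually_le_const hδ, Filter.eventually_gt_atTop 0] with T hT hT0
  rw [neg_div, one_div]
  exact ⟨Real.rpow_pos_of_pos hT0 _, hT⟩

lemma continuous_of_abs_sub_le_iSup {d : ℕ} {K : EuclideanSpace ℝ (Fin d) → ℝ} {L : ℝ}
    (hK : ∀ x y, |K x - K y| ≤ L * ⨆ i, |x i - y i|) : Continuous K := by
  refine (LipschitzWith.of_dist_le' (K := |L|) fun x y => ?_).continuous
  have h0 : 0 ≤ ⨆ i, |x i - y i| := Real.iSup_nonneg fun i => abs_nonneg _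
  have h1 : ⨆ i, |x i - y i| ≤ dist x y := by
    refine Real.iSup_le (fun i => ?_) dist_nonneg
    rw [dist_eq_norm]
    exact PiLp.norm_apply_le (x - y) i
  rw [Real.dist_eq]
  exact (hK x y).trans (mul_le_mul (le_abs_self L) h1 h0 (abs_nonneg L))

lemma norm_le_sqrt_of_abs_le_half {d : ℕ} {z : EuclideanSpace ℝ (Fin d)}
    (hz : ∀ i, |z i| ≤ 1 / 2) : ‖z‖ ≤ Real.sqrt d := by
  rw [EuclideanSpace.norm_eq]
  refine Real.sqrt_le_sqrt ?_
  calc ∑ i, ‖z i‖ ^ 2 ≤ ∑ _i : Fin d, (1 : ℝ) := by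
        refine Finset.sum_le_sum fun i _ => ?_
        have := hz i
        rw [Real.norm_eq_abs]
        exact pow_le_one₀ (abs_nonneg _) (this.trans (by norm_num))
    _ = d := by simp

theorem pointwise_L2_risk_kde
    (d : ℕ) (hd : 1 ≤ d)
    (Ω : Type*) [MeasureSpace Ω] [IsProbabilityMeasure (ℙ : Measure Ω)]
    (X : ℝ → Ω → EuclideanSpace ℝ (Fin d)) (hX : Measurable (Function.uncurry X))
    (ρ : EuclideanSpace ℝ (Fin d) → ℝ) (hρmeas : Measurable ρ) (hρnn : ∀ x, 0 ≤ ρ x)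
    (μ : Measure (EuclideanSpace ℝ (Fin d))) [IsProbabilityMeasure μ]
    (hμρ : μ = volume.withDensity fun x => ENNReal.ofReal (ρ x))
    (p : ℝ → EuclideanSpace ℝ (Fin d) → EuclideanSpace ℝ (Fin d) → ℝ)
    (hpmeas : Measurable fun q : ℝ × EuclideanSpace ℝ (Fin d) × EuclideanSpace ℝ (Fin d) =>
      p q.1 q.2.1 q.2.2)
    (hpnn : ∀ t x y, 0 ≤ p t x y)
    (hlaw : ∀ s : ℝ, 0 ≤ s → Measure.map (X s) ℙ = μ)
    (hpair : ∀ s u : ℝ, 0 ≤ s → s < u →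
      Measure.map (fun ω => (X s ω, X u ω)) ℙ =
        (volume : Measure (EuclideanSpace ℝ (Fin d) × EuclideanSpace ℝ (Fin d))).withDensity
          fun q => ENNReal.ofReal (ρ q.1 * p (u - s) q.1 q.2))
    -- heat kernel bound
    (hheat1 : d = 1 → ∃ a : ℝ → ℝ, Measurable a ∧ (∀ t, 0 ≤ a t) ∧
      (∀ t ∈ Set.Ioc (0 : ℝ) 1, ∀ x y, p t x y ≤ a t) ∧ IntegrableOn a (Set.Ioc 0 1))
    (hheat2 : 2 ≤ d → ∃ c₂ : ℝ, 0 < c₂ ∧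
      ∀ t ∈ Set.Ioc (0 : ℝ) 1, ∀ x y, p t x y ≤ c₂ * t ^ (-(d : ℝ) / 2))
    -- transition density convergence assumption, with constants monotone in S
    (Λ : Set (EuclideanSpace ℝ (Fin d))) (hΛmeas : MeasurableSet Λ) (hΛfull : μ Λ = 1)
    (r : Set (EuclideanSpace ℝ (Fin d)) → ℝ → ℝ)
    (hr : ∀ S, IsCompact S → Measurable (r S) ∧ (∀ t, 0 ≤ r S t) ∧
      (∀ t : ℝ, 1 < t → ∀ x ∈ S ∩ Λ, ∀ y ∈ S, |p t x y - ρ y| ≤ r S t) ∧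
      IntegrableOn (r S) (Set.Ioi 1))
    (hrmono : ∀ S₁ S₂, IsCompact S₁ → IsCompact S₂ → S₁ ⊆ S₂ →
      (∫ t in Set.Ioi (1:ℝ), r S₁ t) ≤ ∫ t in Set.Ioi (1:ℝ), r S₂ t)
    -- kernel of order ℓ, bounded, Lipschitz, supported in [-1/2,1/2]^d
    (K : EuclideanSpace ℝ (Fin d) → ℝ) (ℓ : ℕ)
    (hKbd : ∃ M, ∀ x, |K x| ≤ M)
    (hKlip : ∃ L : ℝ, ∀ x y, |K x - K y| ≤ L * ⨆ i, |x i - y i|)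
    (hKsupp : ∀ x, K x ≠ 0 → ∀ i, |x i| ≤ 1/2)
    (hKord : KernelOrder K ℓ)
    -- Hölder regularity of ρ near x₀
    (x₀ : EuclideanSpace ℝ (Fin d))
    (D : Set (EuclideanSpace ℝ (Fin d))) (hDopen : IsOpen D) (hx₀ : x₀ ∈ D)
    (β L' : ℝ) (hL' : 0 < L') (k : ℕ) (hk : (k : ℝ) < β ∧ β ≤ k + 1)
    (hβ : 0 < β ∧ β ≤ ℓ + 1)
    (hHol : HolderOn D β L' k ρ)
    -- the bandwidth exponent γ' for d ≤ 2
    (γ' : ℝ) (hγ' : 0 < γ' ∧ γ' ≤ β) :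
    ∃ C : ℝ, 0 < C ∧ ∃ T₀ : ℝ, 0 < T₀ ∧ ∀ T : ℝ, T₀ ≤ T →
      (∫⁻ ω, ENNReal.ofReal
          ((kde K X (if d ≤ 2 then T ^ (-(1:ℝ)/γ') else T ^ (-(1:ℝ)/(2*β+(d:ℝ)-2)))
              T x₀ ω - ρ x₀) ^ 2) ∂ℙ)
        ≤ ENNReal.ofReal (C * PhiRate d β T ^ 2) := by
  obtain ⟨M₀, hM₀⟩ := hKbd
  obtain ⟨L, hLip⟩ := hKlip
  have hKcont : Continuous K := continuous_of_abs_sub_le_iSup hLip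
  have hKint : Integrable K := by simpa using hKord.1 (fun _ => 0) (by simp)
  have hkℓ : k ≤ ℓ := by
    have : (k : ℝ) < ℓ + 1 := hk.1.trans_le hβ.2
    exact Nat.lt_succ_iff.1 (by exact_mod_cast this)
  obtain ⟨R, hR0, hRD⟩ := Metric.nhds_basis_closedBall.mem_iff.1 (hDopen.mem_nhds hx₀)
  set B := Real.sqrt d with hB
  have hB0 : 0 < B := Real.sqrt_pos.2 (by exact_mod_cast hd)
  have hKB : ∀ z, K z ≠ 0 → ‖z‖ ≤ B := fun z hz => norm_le_sqrt_of_abs_le_half (hKsupp z hz)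
  set A := ∫ z, |K z| with hA
  have hA0 : 0 ≤ A := integral_nonneg fun _ => abs_nonneg _
  have hM₀0 : 0 ≤ M₀ := (abs_nonneg _).trans (hM₀ 0)
  set S := Metric.closedBall x₀ R with hS
  obtain ⟨hrm, hr0, hrp, hrint⟩ := hr S (isCompact_closedBall x₀ R)
  set Q := (L' * A) ^ 2 + L' * A ^ 2 * ∫ t in Set.Ioi 1, r S t with hQ
  have hQ0 : 0 ≤ Q := add_nonneg (sq_nonneg _)
    (mul_nonneg (by positivity) (integral_nonneg fun t => hr0 t))
  set cb := L' * B ^ β * A with hcb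
  have hXs : ∀ s, Measurable (X s) := fun s => hX.comp measurable_prodMk_left
  have hp : ∀ t, Measurable (Function.uncurry (p t)) := fun t =>
    hpmeas.comp measurable_prodMk_left
  have hΛ : ∀ᵐ y ∂(volume.withDensity fun y => ENNReal.ofReal (ρ y)), y ∈ Λ := by
    rw [← hμρ]
    exact (mem_ae_iff_prob_eq_one hΛmeas).2 hΛfull
  have hlaw' : ∀ s, 0 ≤ s →
      Measure.map (X s) ℙ = volume.withDensity fun y => ENNReal.ofReal (ρ y) :=
    fun s hs => (hlaw s hs).trans hμρ
  have key : ∃ I a b : ℝ, 0 ≤ I ∧ 0 ≤ a ∧ 0 ≤ b ∧ ∀ h T : ℝ, 0 < h → h ≤ 1 → h ≤ R / B → 0 < T →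
      (∫⁻ ω, ENNReal.ofReal ((kde K X h T x₀ ω - ρ x₀) ^ 2) ∂ℙ) ≤
        ENNReal.ofReal (4 / T * ((if d = 1 then I else if d = 2 then a + 2 * b * -Real.log h
          else (a + 2 * b) * h ^ (2 - (d : ℝ))) + Q) + 2 * (cb * h ^ β) ^ 2) := by
    have hrisk : ∀ h T J : ℝ, 0 < h → h ≤ R / B → 0 < T → ∀ e : ℝ → ℝ, (∀ t, 0 ≤ e t) →
        IntegrableOn e (Set.Ioc 0 1) → (∫ t in Set.Ioc 0 1, e t) ≤ J →
        (∀ t, 0 < t → t ≤ 1 → M₀ * (1 / h ^ d) * L' * A ≤ e t ∨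
          ∃ u, (∀ y z, p t y z ≤ u) ∧ u * (L' * A ^ 2) ≤ e t) →
        (∫⁻ ω, ENNReal.ofReal ((kde K X h T x₀ ω - ρ x₀) ^ 2) ∂ℙ) ≤
          ENNReal.ofReal (4 / T * (J + Q) + 2 * (cb * h ^ β) ^ 2) := by
      intro h T J hh hhR hT e he0 heint heJ hep
      have hhB : h * B ≤ R := (le_div_iff₀ hB0).1 hhR
      have hhd : 0 < 1 / h ^ d := by positivity
      set f : EuclideanSpace ℝ (Fin d) → ℝ := fun y => 1 / h ^ d * K (h⁻¹ • (x₀ - y)) with hf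
      have hfm : Measurable f := by
        have : Continuous f := by fun_prop
        exact this.measurable
      have hfM : ∀ y, |f y| ≤ M₀ * (1 / h ^ d) := fun y => by
        simp only [hf]
        rw [abs_mul, abs_of_pos hhd, mul_comm]
        exact mul_le_mul_of_nonneg_right (hM₀ _) hhd.le
      have hfS : ∀ y, f y ≠ 0 → y ∈ S := fun y hy => by
        have h1 := hKB _ (right_ne_zero_of_mul hy)
        rw [norm_smul, norm_inv, Real.norm_eq_abs, abs_of_pos hh, inv_mul_le_iff₀ hh] at h1
        rw [hS, Metric.mem_closedBall', dist_eq_norm]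
        exact h1.trans hhB
      have hfL : ∀ y, f y ≠ 0 → ρ y ≤ L' := fun y hy =>
        (le_abs_self _).trans (hHol.2.1 y (hRD (hfS y hy)))
      have hfint : Integrable f := by
        have h1 : Integrable fun y => K (h⁻¹ • y) := hKint.comp_smul (inv_ne_zero hh.ne')
        exact (h1.comp_sub_left x₀).const_mul _
      have hfA : ∫ y, |f y| = A := by
        rw [hA, ← integral_comp_inv_smul_sub (fun z => |K z|) x₀ hh]
        simp only [hf, abs_mul, abs_of_pos hhd]
      have hfρ : ∫ y, ρ y * f y = ∫ z, K z * ρ (x₀ - h • z) := by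
        rw [← integral_comp_inv_smul_sub (fun z => K z * ρ (x₀ - h • z)) x₀ hh]
        refine integral_congr_ae (.of_forall fun y => ?_)
        simp only [hf]
        rw [smul_inv_smul₀ hh.ne', sub_sub_cancel]
        ring
      have hbias := abs_integral_kernel_mul_sub_le hHol hDopen hL'.le hk.1 hkℓ hKord hρmeas hKB hRD
        hB0.le hh hhB
      have he : ∀ s u, 0 ≤ s → s < u → u - s ≤ 1 →
          |∫ ω, f (X s ω) * f (X u ω) ∂ℙ| ≤ e (u - s) := by
        intro s u hs hsu h1
        rcases hep (u - s) (sub_pos.2 hsu) h1 with h2 | ⟨v, hv, hve⟩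
        · refine le_trans ?_ h2
          have := abs_integral_mul_le_of_marginals (hXs s) (hXs u) hρmeas hρnn (hlaw' s hs)
            (hlaw' u (hs.trans hsu.le)) hfm hfM hfint hfL
          rwa [hfA] at this
        · refine le_trans ?_ hve
          have := abs_integral_mul_le_of_transition_le (hXs s) (hXs u) hρmeas hρnn (hp (u - s))
            (hpnn _) (hpair s u hs hsu) hfm hfM hfint hfL hv
          rwa [hfA] at this
      refine (lintegral_sq_time_average_sub_le hX hρmeas hρnn hp hpnn hlaw' hpair hfm hfM hfint
        hfL hL'.le hfS hΛ hr0 hrint hrp he0 heint he hT (ρ x₀)).trans ?_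
      rw [hfA, hfρ]
      refine ENNReal.ofReal_le_ofReal (add_le_add ?_ ?_)
      · exact mul_le_mul_of_nonneg_left (add_le_add_left heJ _) (by positivity)
      · rw [← sq_abs ((∫ z, K z * ρ (x₀ - h • z)) - ρ x₀)]
        exact mul_le_mul_of_nonneg_left (pow_le_pow_left₀ (abs_nonneg _) hbias 2) zero_le_two
    have hLA : 0 ≤ L' * A ^ 2 := by positivity
    rcases hd.eq_or_lt with h1 | h2
    · obtain ⟨α, -, hα0, hαp, hαint⟩ := hheat1 h1.symm
      refine ⟨∫ t in Set.Ioc 0 1, α t * (L' * A ^ 2), 0, 0,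
        integral_nonneg fun t => mul_nonneg (hα0 t) hLA, le_rfl, le_rfl, ?_⟩
      intro h T hh _ hhR hT
      rw [if_pos h1.symm]
      exact hrisk h T _ hh hhR hT (fun t => α t * (L' * A ^ 2)) (fun t => mul_nonneg (hα0 t) hLA)
        (hαint.mul_const _) le_rfl fun t ht0 ht1 => Or.inr ⟨α t, hαp t ⟨ht0, ht1⟩, le_rfl⟩
    · obtain ⟨c₂, hc₂, hcp⟩ := hheat2 h2
      have ha : 0 ≤ M₀ * L' * A := by positivity
      have hb : 0 ≤ c₂ * (L' * A ^ 2) := by positivity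
      refine ⟨0, M₀ * L' * A, c₂ * (L' * A ^ 2), le_rfl, ha, hb, ?_⟩
      intro h T hh hh1 hhR hT
      rw [if_neg (by omega)]
      obtain ⟨hi, hle⟩ := setIntegral_short_time_le h2 (a := M₀ * L' * A) hb hh hh1
      refine hrisk h T _ hh hhR hT _ (fun t => ?_) hi hle fun t ht0 ht1 => ?_
      · split_ifs with ht
        · positivity
        · have ht0 : 0 ≤ t := (sq_nonneg h).trans (not_le.1 ht).le
          positivity
      · by_cases ht : t ≤ h ^ 2
        · refine Or.inl (le_of_eq ?_)
          rw [if_pos ht]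
          ring
        · refine Or.inr ⟨c₂ * t ^ (-(d : ℝ) / 2), hcp t ⟨ht0, ht1⟩, le_of_eq ?_⟩
          rw [if_neg ht]
          ring
  obtain ⟨I, a, b, hI, ha, hb, hmain⟩ := key
  by_cases hd2 : d ≤ 2
  · have hd12 : d = 1 ∨ d = 2 := by omega
    obtain ⟨T₀, hT₀⟩ := Filter.eventually_atTop.1
      (eventually_bandwidth_le hγ'.1 (lt_min zero_lt_one (div_pos hR0 hB0)))
    have hγi : 0 ≤ γ'⁻¹ := (inv_pos.2 hγ'.1).le
    refine ⟨4 * (I + a + 2 * b * γ'⁻¹ + Q) + 2 * cb ^ 2 + 1, by positivity,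
      max T₀ (Real.exp 1), lt_max_of_lt_right (Real.exp_pos 1), fun T hT => ?_⟩
    have hTe : Real.exp 1 ≤ T := (le_max_right _ _).trans hT
    obtain ⟨hh0, hhδ⟩ := hT₀ T ((le_max_left _ _).trans hT)
    rw [if_pos hd2]
    refine (hmain _ T hh0 (hhδ.trans (min_le_left _ _)) (hhδ.trans (min_le_right _ _))
      ((Real.exp_pos 1).trans_le hTe)).trans (ENNReal.ofReal_le_ofReal ?_)
    have hrate := kde_rate_of_le_two hd12 (c := cb) hγ'.1 hγ'.2 hI ha hb hQ0 hTe
    have hif : ∀ x y z : ℝ, (if d = 1 then x else if d = 2 then y else z) =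
        if d = 1 then x else y := fun x y z => by
      rcases hd12 with rfl | rfl <;> simp
    rw [hif]
    nlinarith [sq_nonneg (PhiRate d β T)]
  · have hd3 : 3 ≤ d := by omega
    have hden : 0 < 2 * β + (d : ℝ) - 2 := by
      have : (3 : ℝ) ≤ d := by exact_mod_cast hd3
      linarith [hβ.1]
    obtain ⟨T₀, hT₀⟩ := Filter.eventually_atTop.1
      (eventually_bandwidth_le hden (lt_min zero_lt_one (div_pos hR0 hB0)))
    refine ⟨4 * (a + 2 * b + Q) + 2 * cb ^ 2 + 1, by positivity,
      max T₀ 1, lt_max_of_lt_right one_pos, fun T hT => ?_⟩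
    have hT1 : 1 ≤ T := (le_max_right _ _).trans hT
    obtain ⟨hh0, hhδ⟩ := hT₀ T ((le_max_left _ _).trans hT)
    rw [if_neg hd2]
    refine (hmain _ T hh0 (hhδ.trans (min_le_left _ _)) (hhδ.trans (min_le_right _ _))
      (one_pos.trans_le hT1)).trans (ENNReal.ofReal_le_ofReal ?_)
    have hrate := kde_rate_of_three_le hd3 (a := a + 2 * b) (c := cb) hβ.1 hQ0 hT1
    rw [if_neg (by omega), if_neg (by omega)]
    nlinarith [sq_nonneg (PhiRate d β T)]
end

section
/- Assume the stationary-densities setting and define b(s) := ∫_{ℝ^d} ( ∫_{ℝ^d} |p_s(x,y) − ρ(y)| dy ) μ(dx) for s > 0. Then for every bounded measurable g : ℝ^d → ℝ and every t > 0: Var( t^{−1/2} ∫₀^t g(X_s) ds ) ≤ 2 ‖g‖_∞² ∫₀^∞ b(s) ds. -/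
open MeasureTheory ProbabilityTheory
open scoped ENNReal

/-- Reflection invariance: the integral of `b |u - s|` over the line is twice the integral of `b`
over the half-line. -/
lemma lintegral_comp_abs_sub (b : ℝ → ℝ≥0∞) (s : ℝ) :
    ∫⁻ u, b |u - s| = 2 * ∫⁻ u in Set.Ioi (0 : ℝ), b u := by
  have hpos : ∫⁻ u in Set.Ioi (0 : ℝ), b |u| = ∫⁻ u in Set.Ioi (0 : ℝ), b u :=
    setLIntegral_congr_fun measurableSet_Ioi fun u hu => by
      simp only [abs_of_pos (Set.mem_Ioi.1 hu)]
  have hneg : ∫⁻ u in Set.Iic (0 : ℝ), b |u| = ∫⁻ u in Set.Ioi (0 : ℝ), b |u| := by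
    have h := (Measure.measurePreserving_neg (volume : Measure ℝ)).setLIntegral_comp_preimage_emb
      (MeasurableEquiv.neg ℝ).measurableEmbedding (fun u => b |u|) (Set.Ici (0 : ℝ))
    simp only [abs_neg, Set.neg_preimage, Set.neg_Ici, neg_zero] at h
    rw [h, setLIntegral_congr Ioi_ae_eq_Ici]
  rw [lintegral_sub_right_eq_self (fun u => b |u|) s,
    ← lintegral_add_compl _ (measurableSet_Ioi (a := (0 : ℝ))), Set.compl_Ioi, hneg, hpos, two_mul]

/-- The covariance of `g U` and `g V` is controlled by the total variation distance, in density
form, between the conditional law of `V` given `U` and the common marginal law. -/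
lemma enorm_covariance_comp_le {E Ω : Type*} [MeasurableSpace E] [MeasurableSpace Ω]
    {P : Measure Ω} [IsProbabilityMeasure P] {ν : Measure E} [SFinite ν]
    {U V : Ω → E} (hU : Measurable U) (hV : Measurable V)
    {ρ : E → ℝ} (hρ : Measurable ρ) (hρ0 : ∀ x, 0 ≤ ρ x)
    {k : E → E → ℝ} (hk : Measurable (Function.uncurry k)) (hk0 : ∀ x y, 0 ≤ k x y)
    (hUρ : P.map U = ν.withDensity fun x => ENNReal.ofReal (ρ x))
    (hVρ : P.map V = ν.withDensity fun x => ENNReal.ofReal (ρ x))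
    (hUV : P.map (fun ω => (U ω, V ω)) =
      (ν.prod ν).withDensity fun q => ENNReal.ofReal (ρ q.1 * k q.1 q.2))
    {g : E → ℝ} (hg : Measurable g) {M : ℝ} (hM : ∀ x, |g x| ≤ M) :
    ‖cov[fun ω => g (U ω), fun ω => g (V ω); P]‖ₑ ≤ ENNReal.ofReal (M ^ 2) *
      ∫⁻ x, (∫⁻ y, ENNReal.ofReal |k x y - ρ y| ∂ν)
        ∂(ν.withDensity fun x => ENNReal.ofReal (ρ x)) := by
  have hkq : Measurable fun q : E × E => k q.1 q.2 := hk
  have hbdd : ∀ x y, |g x * g y| ≤ M ^ 2 := fun x y => by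
    rw [abs_mul, sq]
    exact mul_le_mul (hM x) (hM y) (abs_nonneg _) ((abs_nonneg _).trans (hM x))
  have hprob : IsProbabilityMeasure (P.map U) := Measure.isProbabilityMeasure_map hU.aemeasurable
  have hprob' : IsProbabilityMeasure (P.map fun ω => (U ω, V ω)) :=
    Measure.isProbabilityMeasure_map (hU.prodMk hV).aemeasurable
  have hgU : ∀ {W : Ω → E}, Measurable W → MemLp (fun ω => g (W ω)) 2 P := fun hW =>
    MemLp.of_bound (hg.comp hW).aestronglyMeasurable M (Filter.Eventually.of_forall fun ω => hM _)
  have hmean : ∀ {W : Ω → E}, Measurable W →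
      P.map W = ν.withDensity (fun x => ENNReal.ofReal (ρ x)) →
      ∫ ω, g (W ω) ∂P = ∫ x, ρ x * g x ∂ν := fun {W} hW h => by
    rw [← integral_map (f := g) hW.aemeasurable hg.aestronglyMeasurable, h,
      integral_withDensity_eq_integral_toReal_smul (by fun_prop) (by simp)]
    simp [ENNReal.toReal_ofReal, hρ0]
  have hρint : Integrable (fun x => ρ x * g x) ν := by
    have h : Integrable g (P.map U) :=
      .of_bound hg.aestronglyMeasurable M (Filter.Eventually.of_forall hM)
    rw [hUρ, integrable_withDensity_iff_integrable_smul' (by fun_prop) (by simp)] at h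
    simpa [ENNReal.toReal_ofReal, hρ0] using h
  have hjoint : Integrable (fun q : E × E => ρ q.1 * k q.1 q.2 * (g q.1 * g q.2)) (ν.prod ν) := by
    have h : Integrable (fun q : E × E => g q.1 * g q.2) (P.map fun ω => (U ω, V ω)) :=
      .of_bound (by fun_prop) (M ^ 2) (Filter.Eventually.of_forall fun q => hbdd _ _)
    rw [hUV, integrable_withDensity_iff_integrable_smul' (by fun_prop) (by simp)] at h
    simpa [ENNReal.toReal_ofReal, mul_nonneg, hρ0, hk0] using h
  have hjoint_eq : ∫ ω, g (U ω) * g (V ω) ∂P =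
      ∫ q : E × E, ρ q.1 * k q.1 q.2 * (g q.1 * g q.2) ∂(ν.prod ν) := by
    rw [← integral_map (f := fun q : E × E => g q.1 * g q.2) (hU.prodMk hV).aemeasurable
      (by fun_prop), hUV,
      integral_withDensity_eq_integral_toReal_smul (by fun_prop) (by simp)]
    simp [ENNReal.toReal_ofReal, hρ0, hk0]
  have hcov : cov[fun ω => g (U ω), fun ω => g (V ω); P] =
      ∫ q : E × E, ρ q.1 * (k q.1 q.2 - ρ q.2) * (g q.1 * g q.2) ∂(ν.prod ν) := by
    rw [covariance_eq_sub (hgU hU) (hgU hV), hmean hU hUρ, hmean hV hVρ, ← integral_prod_mul]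
    simp only [Pi.mul_apply]
    rw [hjoint_eq, ← integral_sub hjoint (hρint.mul_prod hρint)]
    congr 1 with q
    ring
  have hmeas : Measurable fun q : E × E => ENNReal.ofReal |k q.1 q.2 - ρ q.2| := by
    fun_prop
  rw [hcov, lintegral_withDensity_eq_lintegral_mul _ (by fun_prop) hmeas.lintegral_prod_right']
  calc ‖∫ q : E × E, ρ q.1 * (k q.1 q.2 - ρ q.2) * (g q.1 * g q.2) ∂(ν.prod ν)‖ₑ
      ≤ ∫⁻ q : E × E, ‖ρ q.1 * (k q.1 q.2 - ρ q.2) * (g q.1 * g q.2)‖ₑ ∂(ν.prod ν) :=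
        enorm_integral_le_lintegral_enorm _
    _ ≤ ∫⁻ q : E × E, ENNReal.ofReal (M ^ 2) *
          (ENNReal.ofReal (ρ q.1) * ENNReal.ofReal |k q.1 q.2 - ρ q.2|) ∂(ν.prod ν) := by
        refine lintegral_mono fun q => ?_
        rw [← ENNReal.ofReal_mul (hρ0 _), ← ENNReal.ofReal_mul (sq_nonneg M),
          Real.enorm_eq_ofReal_abs, abs_mul, abs_mul, abs_of_nonneg (hρ0 _), mul_comm]
        exact ENNReal.ofReal_le_ofReal (mul_le_mul_of_nonneg_right (hbdd _ _)
          (mul_nonneg (hρ0 _) (abs_nonneg _)))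
    _ = _ := by
        rw [lintegral_const_mul _ (by fun_prop), lintegral_prod _ (by fun_prop)]
        congr 1
        refine lintegral_congr fun x => ?_
        have hx : Measurable fun y => ENNReal.ofReal |k x y - ρ y| :=
          hmeas.comp measurable_prodMk_left
        simp only [Pi.mul_apply]
        exact lintegral_const_mul _ hx

/-- The variance of a time integral of a bounded process is the double time integral of its
covariance function. -/
lemma variance_integral_eq_integral_covariance {Ω T : Type*} [MeasurableSpace Ω]
    [MeasurableSpace T] {P : Measure Ω} [IsProbabilityMeasure P] {τ : Measure T}
    [IsFiniteMeasure τ] {f : T → Ω → ℝ} (hf : Measurable (Function.uncurry f))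
    {M : ℝ} (hM : ∀ s ω, |f s ω| ≤ M) :
    Var[fun ω => ∫ s, f s ω ∂τ; P] = ∫ s, ∫ u, cov[f s, f u; P] ∂τ ∂τ := by
  have hf' : Measurable fun q : T × Ω => f q.1 q.2 := hf
  set m : T → ℝ := fun s => ∫ ω, f s ω ∂P
  have hm : Measurable m := hf'.stronglyMeasurable.integral_prod_right'.measurable
  have hmM : ∀ s, |m s| ≤ M := fun s => by
    simpa using norm_integral_le_of_norm_le_const (μ := P) (f := f s)
      (Filter.Eventually.of_forall (hM s))
  have hfint : Integrable (fun q : T × Ω => f q.1 q.2) (τ.prod P) :=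
    .of_bound hf'.aestronglyMeasurable M (Filter.Eventually.of_forall fun q => hM _ _)
  have hslice : ∀ ω, Integrable (fun s => f s ω) τ := fun ω =>
    .of_bound (by fun_prop) M (Filter.Eventually.of_forall fun s => hM _ _)
  have hmint : Integrable m τ :=
    .of_bound hm.aestronglyMeasurable M (Filter.Eventually.of_forall hmM)
  have hmean : ∫ ω, ∫ s, f s ω ∂τ ∂P = ∫ s, m s ∂τ :=
    (integral_integral_swap (f := f) hfint).symm
  have hbdd : ∀ s u ω, |(f s ω - m s) * (f u ω - m u)| ≤ (M + M) * (M + M) := fun s u ω => by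
    have h : ∀ s, |f s ω - m s| ≤ M + M := fun s =>
      (abs_sub _ _).trans (add_le_add (hM s ω) (hmM s))
    rw [abs_mul]
    exact mul_le_mul (h s) (h u) (abs_nonneg _) ((abs_nonneg _).trans (h s))
  have hI : Integrable (fun q : Ω × (T × T) =>
      (f q.2.1 q.1 - m q.2.1) * (f q.2.2 q.1 - m q.2.2)) (P.prod (τ.prod τ)) :=
    .of_bound (by fun_prop) ((M + M) * (M + M)) (Filter.Eventually.of_forall fun q => hbdd _ _ _)
  have hmeasY : Measurable fun ω => ∫ s, f s ω ∂τ :=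
    hf'.stronglyMeasurable.integral_prod_left'.measurable
  rw [variance_eq_integral hmeasY.aemeasurable, hmean]
  calc ∫ ω, (∫ s, f s ω ∂τ - ∫ s, m s ∂τ) ^ 2 ∂P
      = ∫ ω, ∫ r : T × T, (f r.1 ω - m r.1) * (f r.2 ω - m r.2) ∂(τ.prod τ) ∂P := by
        congr 1 with ω
        rw [integral_prod_mul (fun s => f s ω - m s) (fun s => f s ω - m s),
          integral_sub (hslice ω) hmint, sq]
    _ = ∫ r : T × T, ∫ ω, (f r.1 ω - m r.1) * (f r.2 ω - m r.2) ∂P ∂(τ.prod τ) :=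
        integral_integral_swap hI
    _ = _ := integral_prod _ hI.swap.integral_prod_left

/-- Variance bound for normalized additive functionals via the integrated
β-mixing coefficient in density form:
`Var(t^{−1/2} ∫₀^t g(X_s) ds) ≤ 2 ‖g‖_∞² ∫₀^∞ b(s) ds`,
where `b(s) = ∫ ∫ |p_s(x,y) − ρ(y)| dy μ(dx)` (trivially true if the integral is infinite). -/
theorem variance_bound_via_beta_mixing_coefficient
    (d : ℕ) (hd : 1 ≤ d)
    (Ω : Type*) [MeasureSpace Ω] [IsProbabilityMeasure (ℙ : Measure Ω)]
    (X : ℝ → Ω → (Fin d → ℝ)) (hX : Measurable (Function.uncurry X))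
    (ρ : (Fin d → ℝ) → ℝ) (hρmeas : Measurable ρ) (hρnn : ∀ x, 0 ≤ ρ x)
    (μ : Measure (Fin d → ℝ)) [IsProbabilityMeasure μ]
    (hμρ : μ = volume.withDensity fun x => ENNReal.ofReal (ρ x))
    (p : ℝ → (Fin d → ℝ) → (Fin d → ℝ) → ℝ)
    (hpmeas : Measurable fun q : ℝ × (Fin d → ℝ) × (Fin d → ℝ) => p q.1 q.2.1 q.2.2)
    (hpnn : ∀ t x y, 0 ≤ p t x y)
    (hlaw : ∀ s : ℝ, 0 ≤ s → Measure.map (X s) ℙ = μ)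
    (hpair : ∀ s u : ℝ, 0 ≤ s → s < u →
      Measure.map (fun ω => (X s ω, X u ω)) ℙ =
        (volume : Measure ((Fin d → ℝ) × (Fin d → ℝ))).withDensity
          fun q => ENNReal.ofReal (ρ q.1 * p (u - s) q.1 q.2))
    (g : (Fin d → ℝ) → ℝ) (hgmeas : Measurable g)
    (M : ℝ) (hM : ∀ x, |g x| ≤ M)
    (t : ℝ) (ht : 0 < t) :
    ENNReal.ofReal (variance
        (fun ω => (1 / Real.sqrt t) * ∫ s in (0 : ℝ)..t, g (X s ω)) ℙ)
      ≤ ENNReal.ofReal (2 * M ^ 2) *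
          ∫⁻ s in Set.Ioi (0 : ℝ), ∫⁻ x, (∫⁻ y, ENNReal.ofReal |p s x y - ρ y|) ∂μ := by
  have hX' : ∀ s, Measurable (X s) := fun s => hX.of_uncurry_left
  set b : ℝ → ℝ≥0∞ := fun s => ∫⁻ x, (∫⁻ y, ENNReal.ofReal |p s x y - ρ y|) ∂μ with hb
  have hlt : ∀ s u : ℝ, 0 ≤ s → s < u →
      ‖cov[fun ω => g (X s ω), fun ω => g (X u ω); ℙ]‖ₑ ≤ ENNReal.ofReal (M ^ 2) * b (u - s) := by
    intro s u hs hsu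
    have hk : Measurable (Function.uncurry (p (u - s))) :=
      hpmeas.comp (measurable_const.prodMk measurable_id)
    have h := enorm_covariance_comp_le (hX' s) (hX' u) hρmeas hρnn hk (hpnn (u - s))
      ((hlaw s hs).trans hμρ) ((hlaw u (hs.trans hsu.le)).trans hμρ) (hpair s u hs hsu) hgmeas hM
    rwa [← hμρ] at h
  have hne : ∀ s u : ℝ, 0 ≤ s → 0 ≤ u → u ≠ s →
      ‖cov[fun ω => g (X s ω), fun ω => g (X u ω); ℙ]‖ₑ ≤
        ENNReal.ofReal (M ^ 2) * b |u - s| := by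
    intro s u hs hu hus
    rcases hus.lt_or_gt with h | h
    · rw [covariance_comm, abs_sub_comm, abs_of_pos (sub_pos.2 h)]
      exact hlt u s hu h
    · rw [abs_of_pos (sub_pos.2 h)]
      exact hlt s u hs h
  set τ : Measure ℝ := volume.restrict (Set.Ioc 0 t) with hτ
  have hnonneg : ∀ᵐ s ∂τ, 0 ≤ s :=
    (ae_restrict_mem measurableSet_Ioc).mono fun s hs => hs.1.le
  have hvar : Var[fun ω => ∫ s in (0 : ℝ)..t, g (X s ω); ℙ] =
      ∫ s, ∫ u, cov[fun ω => g (X s ω), fun ω => g (X u ω); ℙ] ∂τ ∂τ := by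
    simp only [intervalIntegral.integral_of_le ht.le]
    exact variance_integral_eq_integral_covariance (f := fun s ω => g (X s ω)) (hgmeas.comp hX)
      fun s ω => hM _
  have hbound : ENNReal.ofReal (Var[fun ω => ∫ s in (0 : ℝ)..t, g (X s ω); ℙ]) ≤
      ENNReal.ofReal t * (ENNReal.ofReal (2 * M ^ 2) * ∫⁻ s in Set.Ioi (0 : ℝ), b s) := by
    rw [hvar]
    calc ENNReal.ofReal (∫ s, ∫ u, cov[fun ω => g (X s ω), fun ω => g (X u ω); ℙ] ∂τ ∂τ)
        ≤ ∫⁻ s, ∫⁻ u, ‖cov[fun ω => g (X s ω), fun ω => g (X u ω); ℙ]‖ₑ ∂τ ∂τ :=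
          (Real.ofReal_le_enorm _).trans ((enorm_integral_le_lintegral_enorm _).trans
            (lintegral_mono fun s => enorm_integral_le_lintegral_enorm _))
      _ ≤ ∫⁻ _, (ENNReal.ofReal (2 * M ^ 2) * ∫⁻ u in Set.Ioi (0 : ℝ), b u) ∂τ := by
          refine lintegral_mono_ae (hnonneg.mono fun s hs => ?_)
          calc ∫⁻ u, ‖cov[fun ω => g (X s ω), fun ω => g (X u ω); ℙ]‖ₑ ∂τ
              ≤ ∫⁻ u, ENNReal.ofReal (M ^ 2) * b |u - s| ∂τ := by
                refine lintegral_mono_ae ?_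
                filter_upwards [hnonneg, ae_restrict_of_ae (Measure.ae_ne volume s)] with u hu hus
                exact hne s u hs hu hus
            _ ≤ ∫⁻ u, ENNReal.ofReal (M ^ 2) * b |u - s| := setLIntegral_le_lintegral _ _
            _ = ENNReal.ofReal (2 * M ^ 2) * ∫⁻ u in Set.Ioi (0 : ℝ), b u := by
                rw [lintegral_const_mul' _ _ ENNReal.ofReal_ne_top, lintegral_comp_abs_sub,
                  ENNReal.ofReal_mul zero_le_two, ENNReal.ofReal_ofNat]
                ring
      _ = _ := by
          rw [lintegral_const, hτ, Measure.restrict_apply_univ, Real.volume_Ioc, sub_zero, mul_comm]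
  rw [variance_const_mul, div_pow, one_pow, Real.sq_sqrt ht.le,
    ENNReal.ofReal_mul (one_div_nonneg.2 ht.le)]
  calc _ ≤ ENNReal.ofReal (1 / t) * (ENNReal.ofReal t *
        (ENNReal.ofReal (2 * M ^ 2) * ∫⁻ s in Set.Ioi (0 : ℝ), b s)) := by gcongr
    _ = _ := by
        rw [← mul_assoc, ← ENNReal.ofReal_mul (one_div_nonneg.2 ht.le), one_div_mul_cancel ht.ne',
          ENNReal.ofReal_one, one_mul]
end
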